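/- arXiv:1409.0845 — 11 statements merged into one kernel-verified Lean document; each statement's English description precedes it below -/
import Mathlib

section
/- For every norm N on ℝ² there exist linearly independent vectors v₁, v₂ ∈ ℤ² with the following property. Set Δ = N(v₁) + N(v₂) + N(v₁ − v₂) (the perimeter of the fundamental triangle with vertices 0, v₁, v₂) and let L = {a·v₁ + b·v₂ : a, b ∈ ℤ} be the lattice generated by v₁ and v₂. Then any three pairwise distinct points q₁, q₂, q₃ ∈ L either form a fundamental triangle, i.e. all three pairwise differences q₁ − q₂, q₂ − q₃, q₃ − q₁ belong to the set {v₁, −v₁, v₂, −v₂, v₁ − v₂, v₂ − v₁}, or satisfy N(q₁ − q₂) + N(q₂ − q₃) + N(q₃ − q₁) ≥ Δ + 1. -/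
section Hexagon

variable {E : Type*} [AddCommGroup E] [Module ℝ E] (N : Seminorm ℝ E)

theorem Seminorm.mul_sub_mul_le_of_nonneg {s t : ℝ} (hs : 0 ≤ s) (ht : 0 ≤ t) (x y : E) :
    (s + t) * N x - t * N (x - y) ≤ N (s • x + t • y) := by
  have h := map_add_le_add N (s • x + t • y) (t • (x - y))
  have e : s • x + t • y + t • (x - y) = (s + t) • x := by module
  rw [e, map_smul_eq_mul, map_smul_eq_mul, Real.norm_of_nonneg (by positivity),
    Real.norm_of_nonneg ht] at h
  linarith

/-- The vectors `±x`, `±y`, `±(x - y)` all have seminorm within `C` of `T`. -/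
structure IsAlmostHexagon (T C : ℝ) (x y : E) : Prop where
  left_ge : T - C ≤ N x
  left_le : N x ≤ T + C
  right_ge : T - C ≤ N y
  right_le : N y ≤ T + C
  sub_ge : T - C ≤ N (x - y)
  sub_le : N (x - y) ≤ T + C

namespace IsAlmostHexagon

variable {N} {T C : ℝ} {x y : E}

theorem symm (h : IsAlmostHexagon N T C x y) : IsAlmostHexagon N T C y x :=
  ⟨h.right_ge, h.right_le, h.left_ge, h.left_le, map_sub_rev N x y ▸ h.sub_ge,
    map_sub_rev N x y ▸ h.sub_le⟩

theorem left_sub (h : IsAlmostHexagon N T C x y) : IsAlmostHexagon N T C x (x - y) :=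
  ⟨h.left_ge, h.left_le, h.sub_ge, h.sub_le, by simpa using h.right_ge, by simpa using h.right_le⟩

theorem mul_le_of_le (h : IsAlmostHexagon N T C x y) (hC : 0 ≤ C) {s t : ℝ} (ht : 0 ≤ t)
    (hts : t ≤ s) : s * (T - 3 * C) ≤ N (s • x + t • y) := by
  have h1 := N.mul_sub_mul_le_of_nonneg (ht.trans hts) ht x y
  nlinarith [mul_le_mul_of_nonneg_left h.left_ge (add_nonneg (ht.trans hts) ht),
    mul_le_mul_of_nonneg_left h.sub_le ht, mul_le_mul_of_nonneg_right hts hC]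

theorem eq_zero_of_nonneg (h : IsAlmostHexagon N T C x y) (hC : 0 ≤ C) (hT : 3 * C < T)
    {s t : ℝ} (hs : 0 ≤ s) (ht : 0 ≤ t) (h0 : N (s • x + t • y) = 0) : s = 0 ∧ t = 0 := by
  rcases le_total t s with hts | hts
  · have h1 := h.mul_le_of_le hC ht hts
    have : s = 0 := by nlinarith
    exact ⟨this, by linarith⟩
  · have h1 := h.symm.mul_le_of_le hC hs hts
    rw [add_comm, h0] at h1
    have : t = 0 := by nlinarith
    exact ⟨by linarith, this⟩

theorem eq_zero_of_left_nonneg (h : IsAlmostHexagon N T C x y) (hC : 0 ≤ C) (hT : 3 * C < T)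
    {s t : ℝ} (hs : 0 ≤ s) (h0 : N (s • x + t • y) = 0) : s = 0 ∧ t = 0 := by
  rcases le_total 0 t with ht | ht
  · exact h.eq_zero_of_nonneg hC hT hs ht h0
  rcases le_total (-t) s with hst | hst
  · have e : s • x + t • y = (s + t) • x + (-t) • (x - y) := by module
    have := h.left_sub.eq_zero_of_nonneg hC hT (by linarith) (by linarith) (e ▸ h0)
    constructor <;> linarith [this.1, this.2]
  · have e : s • x + t • y = -((-(s + t)) • y + s • (y - x)) := by module
    rw [e, map_neg_eq_map] at h0
    have := h.symm.left_sub.eq_zero_of_nonneg hC hT (by linarith) hs h0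
    constructor <;> linarith [this.1, this.2]

theorem linearIndependent (h : IsAlmostHexagon N T C x y) (hC : 0 ≤ C) (hT : 3 * C < T) :
    LinearIndependent ℝ ![x, y] := by
  refine LinearIndependent.pair_iff.mpr fun s t hst => ?_
  have h0 : N (s • x + t • y) = 0 := by rw [hst, map_zero]
  rcases le_total 0 s with hs | hs
  · exact h.eq_zero_of_left_nonneg hC hT hs h0
  · have e : s • x + t • y = -((-s) • x + (-t) • y) := by module
    rw [e, map_neg_eq_map] at h0
    simpa using h.eq_zero_of_left_nonneg hC hT (neg_nonneg.mpr hs) h0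

theorem le_of_lt (h : IsAlmostHexagon N T C x y) (hC : 0 ≤ C) {M : ℝ} (hT : 3 * C < T)
    (hM : M ≤ 2 * (T - 3 * C)) {m n : ℤ} (hn : 0 ≤ n) (hnm : n < m) (hm : m ≠ 1) :
    M ≤ N ((m : ℝ) • x + (n : ℝ) • y) := by
  have h2 : (2 : ℝ) ≤ m := by exact_mod_cast (by lia : (2 : ℤ) ≤ m)
  have := h.mul_le_of_le hC (s := m) (t := n) (by exact_mod_cast hn) (by exact_mod_cast hnm.le)
  nlinarith

theorem le_of_nonneg (h : IsAlmostHexagon N T C x y) (hC : 0 ≤ C) {M : ℝ} (hT : 3 * C < T)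
    (hM : M ≤ 2 * (T - 3 * C)) (hxy : M ≤ N (x + y)) {m n : ℤ} (hm : 0 ≤ m) (hn : 0 ≤ n)
    (h2 : 2 ≤ m + n) : M ≤ N ((m : ℝ) • x + (n : ℝ) • y) := by
  rcases lt_trichotomy n m with hnm | rfl | hnm
  · exact h.le_of_lt hC hT hM hn hnm (by lia)
  · rw [← smul_add, map_smul_eq_mul, Real.norm_of_nonneg (by exact_mod_cast hm)]
    have : (1 : ℝ) ≤ n := by exact_mod_cast (by lia : (1 : ℤ) ≤ n)
    nlinarith [apply_nonneg N (x + y)]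
  · rw [add_comm]
    exact h.symm.le_of_lt hC hT hM hm hnm (by lia)

theorem le_of_left_nonneg (h : IsAlmostHexagon N T C x y) (hC : 0 ≤ C) {M : ℝ} (hT : 3 * C < T)
    (hM : M ≤ 2 * (T - 3 * C)) (h₁ : M ≤ N (x + y)) (h₂ : M ≤ N (x + (x - y)))
    (h₃ : M ≤ N (y + (y - x))) {m n : ℤ} (hm : 0 ≤ m) (h0 : ¬(m = 0 ∧ n = 0))
    (hx : ¬(m = 1 ∧ n = 0)) (hy : ¬(m = 0 ∧ n = 1)) (hy' : ¬(m = 0 ∧ n = -1))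
    (hxy : ¬(m = 1 ∧ n = -1)) : M ≤ N ((m : ℝ) • x + (n : ℝ) • y) := by
  rcases le_total 0 n with hn | hn
  · exact h.le_of_nonneg hC hT hM h₁ hm hn (by lia)
  rcases le_total (-n) m with hnm | hnm
  · have e : (m : ℝ) • x + (n : ℝ) • y = ((m + n : ℤ) : ℝ) • x + ((-n : ℤ) : ℝ) • (x - y) := by
      push_cast; module
    rw [e]
    exact h.left_sub.le_of_nonneg hC hT hM h₂ (by lia) (by lia) (by lia)
  · have e : (m : ℝ) • x + (n : ℝ) • y =
        -(((-(m + n) : ℤ) : ℝ) • y + ((m : ℤ) : ℝ) • (y - x)) := by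
      push_cast; module
    rw [e, map_neg_eq_map]
    exact h.symm.left_sub.le_of_nonneg hC hT hM h₃ (by lia) (by lia) (by lia)

/-- A nonzero vector of the lattice generated by an almost regular hexagon is either a vertex
of the hexagon or at least as long as the second shortest vectors. -/
theorem mem_or_le (h : IsAlmostHexagon N T C x y) (hC : 0 ≤ C) {M : ℝ} (hT : 3 * C < T)
    (hM : M ≤ 2 * (T - 3 * C)) (h₁ : M ≤ N (x + y)) (h₂ : M ≤ N (x + (x - y)))
    (h₃ : M ≤ N (y + (y - x))) (m n : ℤ) (h0 : (m : ℝ) • x + (n : ℝ) • y ≠ 0) :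
    (m : ℝ) • x + (n : ℝ) • y ∈ ({x, -x, y, -y, x - y, y - x} : Set E) ∨
      M ≤ N ((m : ℝ) • x + (n : ℝ) • y) := by
  refine or_iff_not_imp_left.mpr fun hS => ?_
  have hz : ¬(m = 0 ∧ n = 0) := by rintro ⟨rfl, rfl⟩; simp at h0
  have k₁ : ¬(m = 1 ∧ n = 0) := by rintro ⟨rfl, rfl⟩; simp at hS
  have k₂ : ¬(m = 0 ∧ n = 1) := by rintro ⟨rfl, rfl⟩; simp at hS
  have k₃ : ¬(m = 0 ∧ n = -1) := by rintro ⟨rfl, rfl⟩; simp at hS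
  have k₄ : ¬(m = 1 ∧ n = -1) := by rintro ⟨rfl, rfl⟩; simp [← sub_eq_add_neg] at hS
  have k₅ : ¬(m = -1 ∧ n = 0) := by rintro ⟨rfl, rfl⟩; simp at hS
  have k₆ : ¬(m = -1 ∧ n = 1) := by
    rintro ⟨rfl, rfl⟩; simp [neg_add_eq_sub] at hS
  rcases le_total 0 m with hm | hm
  · exact h.le_of_left_nonneg hC hT hM h₁ h₂ h₃ hm hz k₁ k₂ k₃ k₄
  · have e : (m : ℝ) • x + (n : ℝ) • y = -(((-m : ℤ) : ℝ) • x + ((-n : ℤ) : ℝ) • y) := by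
      push_cast; module
    rw [e, map_neg_eq_map]
    apply h.le_of_left_nonneg hC hT hM h₁ h₂ h₃ <;> lia

theorem le_of_mem_or_le (h : IsAlmostHexagon N T C x y) {M : ℝ} (hM : T - C ≤ M) {z : E}
    (hz : z ∈ ({x, -x, y, -y, x - y, y - x} : Set E) ∨ M ≤ N z) : T - C ≤ N z := by
  rcases hz with hz | hz
  · simp only [Set.mem_insert_iff, Set.mem_singleton_iff] at hz
    rcases hz with rfl | rfl | rfl | rfl | rfl | rfl
    · exact h.left_ge
    · simpa using h.left_ge
    · exact h.right_ge
    · simpa using h.right_ge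
    · exact h.sub_ge
    · exact h.symm.sub_ge
  · exact hM.trans hz

theorem perimeter_gap (h : IsAlmostHexagon N T C x y) (hC : 0 ≤ C) (hT : 11 * C + 1 ≤ T)
    (h₁ : T + 5 * C + 1 ≤ N (x + y)) (h₂ : T + 5 * C + 1 ≤ N (x + (x - y)))
    (h₃ : T + 5 * C + 1 ≤ N (y + (y - x))) {q₁ q₂ q₃ : E}
    (hq₁ : ∃ a b : ℤ, q₁ = (a : ℝ) • x + (b : ℝ) • y)
    (hq₂ : ∃ a b : ℤ, q₂ = (a : ℝ) • x + (b : ℝ) • y)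
    (hq₃ : ∃ a b : ℤ, q₃ = (a : ℝ) • x + (b : ℝ) • y)
    (h₁₂ : q₁ ≠ q₂) (h₂₃ : q₂ ≠ q₃) (h₃₁ : q₃ ≠ q₁) :
    (q₁ - q₂ ∈ ({x, -x, y, -y, x - y, y - x} : Set E) ∧
      q₂ - q₃ ∈ ({x, -x, y, -y, x - y, y - x} : Set E) ∧
      q₃ - q₁ ∈ ({x, -x, y, -y, x - y, y - x} : Set E)) ∨
      N x + N y + N (x - y) + 1 ≤ N (q₁ - q₂) + N (q₂ - q₃) + N (q₃ - q₁) := by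
  have key {p q : E} (hp : ∃ a b : ℤ, p = (a : ℝ) • x + (b : ℝ) • y)
      (hq : ∃ a b : ℤ, q = (a : ℝ) • x + (b : ℝ) • y) (hpq : p ≠ q) :
      p - q ∈ ({x, -x, y, -y, x - y, y - x} : Set E) ∨ T + 5 * C + 1 ≤ N (p - q) := by
    obtain ⟨a, b, rfl⟩ := hp
    obtain ⟨c, d, rfl⟩ := hq
    have e : (a : ℝ) • x + (b : ℝ) • y - ((c : ℝ) • x + (d : ℝ) • y) =
        ((a - c : ℤ) : ℝ) • x + ((b - d : ℤ) : ℝ) • y := by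
      push_cast; module
    have hne := sub_ne_zero.mpr hpq
    rw [e] at hne ⊢
    exact h.mem_or_le hC (by linarith) (by linarith) h₁ h₂ h₃ _ _ hne
  have k₁ := key hq₁ hq₂ h₁₂
  have k₂ := key hq₂ hq₃ h₂₃
  have k₃ := key hq₃ hq₁ h₃₁
  have l₁ := h.le_of_mem_or_le (by linarith) k₁
  have l₂ := h.le_of_mem_or_le (by linarith) k₂
  have l₃ := h.le_of_mem_or_le (by linarith) k₃
  have u₁ := h.left_le
  have u₂ := h.right_le
  have u₃ := h.sub_le
  rcases k₁ with k₁ | k₁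
  · rcases k₂ with k₂ | k₂
    · rcases k₃ with k₃ | k₃
      · exact Or.inl ⟨k₁, k₂, k₃⟩
      · right; linarith
    · right; linarith
  · right; linarith

end IsAlmostHexagon

/-- The unit ball has an inscribed affinely regular hexagon `±x`, `±y`, `±(x - y)` whose
lattice has no further vectors of norm one. -/
def HasStrictHexagon : Prop :=
  ∃ x y : E, N x = 1 ∧ N y = 1 ∧ N (x - y) = 1 ∧
    1 < N (x + y) ∧ 1 < N (x + (x - y)) ∧ 1 < N (y + (y - x))

variable {N}

theorem hasStrictHexagon_of_parallelogram {x y : E} (hx : N x = 1) (hy : N y = 1)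
    (hadd : N (x + y) = 1) (hsub : N (x - y) = 1) : HasStrictHexagon N := by
  have half (z : E) : N ((1 / 2 : ℝ) • z) = 1 / 2 * N z := by
    rw [map_smul_eq_mul, Real.norm_of_nonneg (by norm_num)]
  have three : N ((3 : ℝ) • x) = 3 := by
    rw [map_smul_eq_mul, hx, Real.norm_of_nonneg (by norm_num), mul_one]
  have two : N ((2 : ℝ) • y) = 2 := by
    rw [map_smul_eq_mul, hy, Real.norm_of_nonneg (by norm_num), mul_one]
  have dbl : N ((2 : ℝ) • y) ≤ N ((1 / 2 : ℝ) • x + y) + N (y - (1 / 2 : ℝ) • x) := by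
    refine le_of_eq_of_le ?_ (map_add_le_add N _ _)
    congr 1; module
  have upper_add : N ((1 / 2 : ℝ) • x + y) ≤ 1 := by
    have h := map_add_le_add N ((1 / 2 : ℝ) • (x + y)) ((1 / 2 : ℝ) • y)
    rw [half, half, hadd, hy] at h
    have e : (1 / 2 : ℝ) • (x + y) + (1 / 2 : ℝ) • y = (1 / 2 : ℝ) • x + y := by module
    rw [e] at h; linarith
  have upper_sub : N (y - (1 / 2 : ℝ) • x) ≤ 1 := by
    have h := map_sub_le_add N ((1 / 2 : ℝ) • y) ((1 / 2 : ℝ) • (x - y))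
    rw [half, half, hsub, hy] at h
    have e : (1 / 2 : ℝ) • y - (1 / 2 : ℝ) • (x - y) = y - (1 / 2 : ℝ) • x := by module
    rw [e] at h; linarith
  have long_add : N ((3 / 2 : ℝ) • x + y) ≤ 3 / 2 := by
    have h := map_add_le_add N ((1 / 2 : ℝ) • x) (x + y)
    rw [half, hx, hadd] at h
    have e : (1 / 2 : ℝ) • x + (x + y) = (3 / 2 : ℝ) • x + y := by module
    rw [e] at h; linarith
  have long_sub : N ((3 / 2 : ℝ) • x - y) ≤ 3 / 2 := by
    have h := map_add_le_add N ((1 / 2 : ℝ) • x) (x - y)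
    rw [half, hx, hsub] at h
    have e : (1 / 2 : ℝ) • x + (x - y) = (3 / 2 : ℝ) • x - y := by module
    rw [e] at h; linarith
  have long : N ((3 : ℝ) • x) ≤ N ((3 / 2 : ℝ) • x + y) + N ((3 / 2 : ℝ) • x - y) := by
    refine le_of_eq_of_le ?_ (map_add_le_add N _ _)
    congr 1; module
  refine ⟨x, (1 / 2 : ℝ) • x + y, hx, by linarith, ?_, ?_, ?_, ?_⟩
  · have e : x - ((1 / 2 : ℝ) • x + y) = -(y - (1 / 2 : ℝ) • x) := by module
    rw [e, map_neg_eq_map]; linarith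
  · have e : x + ((1 / 2 : ℝ) • x + y) = (3 / 2 : ℝ) • x + y := by module
    rw [e]; linarith
  · have e : x + (x - ((1 / 2 : ℝ) • x + y)) = (3 / 2 : ℝ) • x - y := by module
    rw [e]; linarith
  · have e : (1 / 2 : ℝ) • x + y + ((1 / 2 : ℝ) • x + y - x) = (2 : ℝ) • y := by module
    rw [e]; linarith

theorem Seminorm.one_le_apply_add {x y : E} (hx : N x = 1) (hsub : N (x - y) = 1) :
    1 ≤ N (x + y) := by
  have h := N.mul_sub_mul_le_of_nonneg zero_le_one zero_le_one x y
  rw [hx, hsub, one_smul, one_smul] at h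
  linarith

theorem hasStrictHexagon_of_hexagon {x y : E} (hx : N x = 1) (hy : N y = 1)
    (hsub : N (x - y) = 1) : HasStrictHexagon N := by
  have hsub' : N (y - x) = 1 := by rwa [map_sub_rev]
  rcases (Seminorm.one_le_apply_add hx hsub).eq_or_lt with h₁ | h₁
  · exact hasStrictHexagon_of_parallelogram hx hy h₁.symm hsub
  rcases (Seminorm.one_le_apply_add hx (y := x - y) (by simpa using hy)).eq_or_lt with h₂ | h₂
  · exact hasStrictHexagon_of_parallelogram hx hsub h₂.symm (by simpa using hy)
  rcases (Seminorm.one_le_apply_add hy (y := y - x) (by simpa using hx)).eq_or_lt with h₃ | h₃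
  · exact hasStrictHexagon_of_parallelogram hy hsub' h₃.symm (by simpa using hx)
  exact ⟨x, y, hx, hy, hsub, h₁, h₂, h₃⟩

theorem hasStrictHexagon_of_linearIndependent (hN : ∀ x, N x = 0 → x = 0) {e w : E}
    (h : LinearIndependent ℝ ![e, w]) : HasStrictHexagon N := by
  rw [LinearIndependent.pair_iff] at h
  have he : e ≠ 0 := by
    rintro rfl
    simpa using h 1 0 (by simp)
  have hNe : N e ≠ 0 := fun h0 => he (hN e h0)
  set a : E := (N e)⁻¹ • e with ha
  have hNa : N a = 1 := by
    rw [ha, map_smul_eq_mul, norm_inv, Real.norm_of_nonneg (apply_nonneg N e),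
      inv_mul_cancel₀ hNe]
  have hcont : Continuous fun q : ℝ × ℝ => N (q.1 • a + q.2 • w) := by
    let φ : ℝ × ℝ →ₗ[ℝ] E :=
      (LinearMap.fst ℝ ℝ ℝ).smulRight a + (LinearMap.snd ℝ ℝ ℝ).smulRight w
    have : ConvexOn ℝ Set.univ (N.comp φ) := (N.comp φ).convexOn
    exact continuousOn_univ.mp (this.continuousOn isOpen_univ)
  have hγ (t : ℝ) : N (Real.cos t • a + Real.sin t • w) ≠ 0 := by
    intro h0
    have h1 := hN _ h0
    rw [ha, smul_smul] at h1
    obtain ⟨hc, hs⟩ := h _ _ h1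
    have hc' : Real.cos t = 0 := by simpa [hNe] using hc
    have := Real.sin_sq_add_cos_sq t
    rw [hs, hc'] at this
    norm_num at this
  have hγc : Continuous fun t : ℝ => N (Real.cos t • a + Real.sin t • w) :=
    hcont.comp (Real.continuous_cos.prodMk Real.continuous_sin)
  let b : ℝ → E := fun t =>
    (N (Real.cos t • a + Real.sin t • w))⁻¹ • (Real.cos t • a + Real.sin t • w)
  have hNb (t : ℝ) : N (b t) = 1 := by
    simp only [b]
    rw [map_smul_eq_mul, norm_inv, Real.norm_of_nonneg (apply_nonneg N _), inv_mul_cancel₀ (hγ t)]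
  have hbc : Continuous fun t => N (a - b t) := by
    have hinv := hγc.inv₀ hγ
    have := hcont.comp (((continuous_const (y := (1 : ℝ))).sub (hinv.mul Real.continuous_cos)).prodMk
      (hinv.mul Real.continuous_sin).neg)
    refine this.congr fun t => ?_
    simp only [Function.comp, b, Pi.sub_apply, Pi.neg_apply, Pi.mul_apply, Pi.inv_apply]
    congr 1
    module
  have h0 : N (a - b 0) = 0 := by simp [b, hNa]
  have hπ : N (a - b Real.pi) = 2 := by
    have e : a - b Real.pi = (2 : ℝ) • a := by
      simp [b, hNa]
      module
    rw [e, map_smul_eq_mul, hNa]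
    norm_num
  obtain ⟨t, -, ht⟩ := intermediate_value_Icc Real.pi_pos.le hbc.continuousOn
    (show (1 : ℝ) ∈ Set.Icc (N (a - b 0)) (N (a - b Real.pi)) by
      rw [h0, hπ]; constructor <;> norm_num)
  exact hasStrictHexagon_of_hexagon hNa (hNb t) ht

end Hexagon

theorem Seminorm.sub_round_le (N : Seminorm ℝ (Fin 2 → ℝ)) (x : Fin 2 → ℝ) :
    N ((fun i => (round (x i) : ℝ)) - x) ≤ N (Pi.single 0 1) + N (Pi.single 1 1) := by
  set z : Fin 2 → ℝ := (fun i => (round (x i) : ℝ)) - x with hz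
  have hz1 (i : Fin 2) : ‖z i‖ ≤ 1 := by
    have := abs_sub_round (x i)
    rw [abs_sub_comm] at this
    simp only [hz, Pi.sub_apply, Real.norm_eq_abs]
    linarith
  have e : z = z 0 • Pi.single 0 1 + z 1 • Pi.single 1 1 := by
    ext i; fin_cases i <;> simp
  rw [e]
  refine (map_add_le_add N _ _).trans (add_le_add ?_ ?_) <;> rw [map_smul_eq_mul] <;>
    exact mul_le_of_le_one_left (apply_nonneg N _) (hz1 _)

theorem Seminorm.abs_apply_sub_smul_le {E : Type*} [AddCommGroup E] [Module ℝ E]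
    (N : Seminorm ℝ E) {T K : ℝ} (hT : 0 ≤ T) {x y : E} (h : N (x - T • y) ≤ K) :
    T * N y - K ≤ N x ∧ N x ≤ T * N y + K := by
  have h1 := (abs_le.mp ((abs_sub_map_le_sub N x (T • y)).trans h))
  rw [map_smul_eq_mul, Real.norm_of_nonneg hT] at h1
  constructor <;> linarith [h1.1, h1.2]

/-- For every norm `N` on `ℝ²` there exist linearly independent integer vectors `v₁, v₂`
generating a lattice in which any three pairwise distinct points either form a fundamental
triangle or form a triangle of `N`-perimeter at least `Δ + 1`, where `Δ` is the perimeter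
of the fundamental triangle with vertices `0, v₁, v₂`. -/
theorem stmt_0 (N : (Fin 2 → ℝ) → ℝ)
    (hN0 : ∀ x, N x = 0 ↔ x = 0)
    (hNsmul : ∀ (c : ℝ) (x : Fin 2 → ℝ), N (c • x) = |c| * N x)
    (hNadd : ∀ x y : Fin 2 → ℝ, N (x + y) ≤ N x + N y) :
    ∃ w₁ w₂ : Fin 2 → ℤ,
      let v₁ : Fin 2 → ℝ := fun i => (w₁ i : ℝ)
      let v₂ : Fin 2 → ℝ := fun i => (w₂ i : ℝ)
      let Δ : ℝ := N v₁ + N v₂ + N (v₁ - v₂)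
      let L : Set (Fin 2 → ℝ) := {p | ∃ a b : ℤ, p = (a : ℝ) • v₁ + (b : ℝ) • v₂}
      let S : Set (Fin 2 → ℝ) := {v₁, -v₁, v₂, -v₂, v₁ - v₂, v₂ - v₁}
      LinearIndependent ℝ ![v₁, v₂] ∧
        ∀ q₁ q₂ q₃ : Fin 2 → ℝ, q₁ ∈ L → q₂ ∈ L → q₃ ∈ L →
          q₁ ≠ q₂ → q₂ ≠ q₃ → q₃ ≠ q₁ →
          (q₁ - q₂ ∈ S ∧ q₂ - q₃ ∈ S ∧ q₃ - q₁ ∈ S) ∨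
            Δ + 1 ≤ N (q₁ - q₂) + N (q₂ - q₃) + N (q₃ - q₁) := by
  let P : Seminorm ℝ (Fin 2 → ℝ) := Seminorm.of N hNadd hNsmul
  have hind : LinearIndependent ℝ ![(Pi.single 0 1 : Fin 2 → ℝ), Pi.single 1 1] := by
    refine LinearIndependent.pair_iff.mpr fun s t hst => ?_
    exact ⟨by simpa using congrFun hst 0, by simpa using congrFun hst 1⟩
  obtain ⟨x, y, hx, hy, hxy, h₁, h₂, h₃⟩ :=
    hasStrictHexagon_of_linearIndependent (N := P) (fun z hz => (hN0 z).mp hz) hind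
  set K : ℝ := P (Pi.single 0 1) + P (Pi.single 1 1)
  have hK0 : 0 ≤ K := add_nonneg (apply_nonneg P _) (apply_nonneg P _)
  obtain ⟨T, hT, hT₁, hT₂, hT₃⟩ : ∃ T : ℝ, 22 * K + 1 ≤ T ∧
      13 * K + 1 ≤ T * (P (x + y) - 1) ∧ 13 * K + 1 ≤ T * (P (x + (x - y)) - 1) ∧
      13 * K + 1 ≤ T * (P (y + (y - x)) - 1) := by
    have large {c : ℝ} (hc : 1 < c) : ∀ᶠ T : ℝ in Filter.atTop, 13 * K + 1 ≤ T * (c - 1) :=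
      (Filter.tendsto_id.atTop_mul_const (sub_pos.mpr hc)).eventually_ge_atTop _
    exact ((Filter.eventually_ge_atTop _).and
      ((large h₁).and ((large h₂).and (large h₃)))).exists
  have hT0 : 0 ≤ T := by linarith
  let w₁ : Fin 2 → ℤ := fun i => round ((T • x) i)
  let w₂ : Fin 2 → ℤ := fun i => round ((T • y) i)
  refine ⟨w₁, w₂, ?_⟩
  intro v₁ v₂ Δ L S
  have d₁ : P (v₁ - T • x) ≤ K := P.sub_round_le (T • x)
  have d₂ : P (v₂ - T • y) ≤ K := P.sub_round_le (T • y)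
  have dsub : P (v₁ - v₂ - T • (x - y)) ≤ 2 * K := by
    have e : v₁ - v₂ - T • (x - y) = (v₁ - T • x) - (v₂ - T • y) := by module
    rw [e]
    linarith [map_sub_le_add P (v₁ - T • x) (v₂ - T • y)]
  have dsub' : P (v₂ - v₁ - T • (y - x)) ≤ 2 * K := by
    have e : v₂ - v₁ - T • (y - x) = -(v₁ - v₂ - T • (x - y)) := by module
    rwa [e, map_neg_eq_map]
  have dadd {a b c d : Fin 2 → ℝ} {A B : ℝ} (hac : P (a - T • c) ≤ A) (hbd : P (b - T • d) ≤ B) :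
      P (a + b - T • (c + d)) ≤ A + B := by
    have e : a + b - T • (c + d) = (a - T • c) + (b - T • d) := by module
    rw [e]
    exact (map_add_le_add P _ _).trans (add_le_add hac hbd)
  have b₁ := P.abs_apply_sub_smul_le hT0 d₁
  have b₂ := P.abs_apply_sub_smul_le hT0 d₂
  have b₃ := P.abs_apply_sub_smul_le hT0 dsub
  have b₄ := P.abs_apply_sub_smul_le hT0 (dadd d₁ d₂)
  have b₅ := P.abs_apply_sub_smul_le hT0 (dadd d₁ dsub)
  have b₆ := P.abs_apply_sub_smul_le hT0 (dadd d₂ dsub')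
  rw [hx] at b₁
  rw [hy] at b₂
  rw [hxy] at b₃
  have hex : IsAlmostHexagon P T (2 * K) v₁ v₂ := by
    constructor <;> linarith [b₁.1, b₁.2, b₂.1, b₂.2, b₃.1, b₃.2]
  refine ⟨hex.linearIndependent (by linarith) (by linarith), ?_⟩
  intro q₁ q₂ q₃ hq₁ hq₂ hq₃ h₁₂ h₂₃ h₃₁
  exact hex.perimeter_gap (by linarith) (by linarith) (by linarith [b₄.1]) (by linarith [b₅.1])
    (by linarith [b₆.1]) hq₁ hq₂ hq₃ h₁₂ h₂₃ h₃₁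
end

section
/- Let N be a norm on ℝ² with N((1,0)) = 1, let α be a positive integer, and set p₀ = (0,0), p₁ = (α,0), p₂ = (2α,0), p₃ = (3α,0). Then there exists a point p₄ ∈ ℝ² with rational coordinates and strictly positive second coordinate such that α < N(p₄ − p₁) ≤ 4α/3, α < N(p₄ − p₂) ≤ 4α/3, N(p₄ − p₀) > 4α/3, and N(p₄ − p₃) > 4α/3. -/
open Filter Topology

/-- Three-point form of convexity for a function on the real line. -/
def ThreePointConvex (f : ℝ → ℝ) : Prop :=
  ∀ a b c, a ≤ b → b ≤ c → (c - a) * f b ≤ (c - b) * f a + (b - a) * f c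

/-- If a convex function takes the value `4 / 3` at `t` and `t + 1` and at most `4 / 3` at `t + 2`,
an intermediate value argument finds a unit interval in `[t, t + 2]` that is balanced in the sense
that `f (z - 1) = f (z + 2)`. -/
lemma ThreePointConvex.exists_balanced_of_le {f : ℝ → ℝ} (hf : ThreePointConvex f)
    (hc : Continuous f) (h3 : ∀ x, 3 ≤ f x + f (x + 3)) {t : ℝ} (h0 : f t = 4 / 3)
    (h1 : f (t + 1) = 4 / 3) (h2 : f (t + 2) ≤ 4 / 3) :
    ∃ z, (1 < f z ∧ f z ≤ 4 / 3) ∧ (1 < f (z + 1) ∧ f (z + 1) ≤ 4 / 3) ∧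
      4 / 3 < f (z - 1) ∧ 4 / 3 < f (z + 2) := by
  have hg : ContinuousOn (fun z => f (z + 2) - f (z - 1)) (Set.Icc t (t + 1)) := by fun_prop
  have hl : f (t + 2) - f (t - 1) ≤ 0 := by
    have := h3 (t - 1)
    rw [show t - 1 + 3 = t + 2 by ring] at this
    linarith
  have hr : 0 ≤ f (t + 1 + 2) - f (t + 1 - 1) := by
    have := h3 t
    rw [show t + 1 + 2 = t + 3 by ring, show t + 1 - 1 = t by ring]
    linarith
  obtain ⟨z, ⟨hz0, hz1⟩, hz⟩ := intermediate_value_Icc (by linarith) hg ⟨hl, hr⟩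
  have hz' : f (z + 2) - f (z - 1) = 0 := hz
  have hsum := h3 (z - 1)
  rw [show z - 1 + 3 = z + 2 by ring] at hsum
  have e1 := hf z (t + 1) (t + 2) hz1 (by linarith)
  have e2 := hf t (t + 1) (z + 1) (by linarith) (by linarith)
  have e3 := hf t z (t + 2) hz0 (by linarith)
  have e4 := hf t (z + 1) (t + 2) (by linarith) (by linarith)
  rw [h1] at e1 e2
  rw [h0] at e2 e3 e4
  refine ⟨z, ⟨?_, ?_⟩, ⟨?_, ?_⟩, ?_, ?_⟩ <;> nlinarith

lemma ThreePointConvex.exists_unit_interval {f : ℝ → ℝ} (hf : ThreePointConvex f)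
    (hc : Continuous f) (h3 : ∀ x, 3 ≤ f x + f (x + 3)) {t : ℝ} (h0 : f t = 4 / 3)
    (h1 : f (t + 1) = 4 / 3) :
    ∃ z, (1 < f z ∧ f z ≤ 4 / 3) ∧ (1 < f (z + 1) ∧ f (z + 1) ≤ 4 / 3) ∧
      4 / 3 < f (z - 1) ∧ 4 / 3 < f (z + 2) := by
  by_cases hr : f (t + 2) ≤ 4 / 3
  · exact hf.exists_balanced_of_le hc h3 h0 h1 hr
  by_cases hl : f (t - 1) ≤ 4 / 3
  · have hf' : ThreePointConvex (fun x => f (-x)) := fun a b c hab hbc => by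
      have := hf (-c) (-b) (-a) (by linarith) (by linarith)
      linarith
    obtain ⟨z, hz0, hz1, hz2, hz3⟩ := hf'.exists_balanced_of_le (t := -t - 1) (by fun_prop)
      (fun x => by
        have := h3 (-x - 3)
        rw [show -x - 3 + 3 = -x by ring] at this
        rw [show -(x + 3) = -x - 3 by ring]
        linarith)
      (by rw [← h1]; ring_nf) (by rw [← h0]; ring_nf) (by convert hl using 2; ring)
    refine ⟨-z - 1, ?_, ?_, ?_, ?_⟩
    · rwa [show -z - 1 = -(z + 1) by ring]
    · rwa [show -z - 1 + 1 = -z by ring]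
    · rwa [show -z - 1 - 1 = -(z + 2) by ring]
    · rwa [show -z - 1 + 2 = -(z - 1) by ring]
  · refine ⟨t, ?_, ?_, by linarith, by linarith⟩ <;> constructor <;> linarith

/-- `F x y` is a norm of the vector `(x, y)` with `F 1 0 = 1`. -/
structure IsNormalizedPlaneNorm (F : ℝ → ℝ → ℝ) : Prop where
  eq_zero : ∀ x y, F x y = 0 → x = 0 ∧ y = 0
  smul : ∀ c x y, F (c * x) (c * y) = |c| * F x y
  add : ∀ x y x' y', F (x + x') (y + y') ≤ F x y + F x' y'
  one : F 1 0 = 1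

namespace IsNormalizedPlaneNorm

variable {F : ℝ → ℝ → ℝ}

lemma horizontal (hF : IsNormalizedPlaneNorm F) (x : ℝ) : F x 0 = |x| := by
  have := hF.smul x 1 0
  rwa [mul_one, mul_zero, hF.one, mul_one] at this

lemma neg (hF : IsNormalizedPlaneNorm F) (x y : ℝ) : F (-x) (-y) = F x y := by
  have := hF.smul (-1) x y
  rwa [abs_neg, abs_one, one_mul, neg_one_mul, neg_one_mul] at this

lemma nonneg (hF : IsNormalizedPlaneNorm F) (x y : ℝ) : 0 ≤ F x y := by
  have := hF.add x y (-x) (-y)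
  rw [hF.neg, add_neg_cancel, add_neg_cancel, hF.horizontal, abs_zero] at this
  linarith

lemma vertical_pos (hF : IsNormalizedPlaneNorm F) : 0 < F 0 1 :=
  (hF.nonneg 0 1).lt_of_ne fun h => one_ne_zero (hF.eq_zero 0 1 h.symm).2

lemma le_add (hF : IsNormalizedPlaneNorm F) (x y x' y' : ℝ) :
    F x y ≤ F x' y' + (|x - x'| + |y - y'| * F 0 1) := by
  have h1 := hF.add x' y' (x - x') (y - y')
  have h2 := hF.add (x - x') 0 0 (y - y')
  have h3 := hF.smul (y - y') 0 1
  rw [hF.horizontal] at h2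
  simp only [mul_zero, mul_one, add_zero, zero_add, add_sub_cancel] at h1 h2 h3
  linarith

lemma continuous (hF : IsNormalizedPlaneNorm F) : Continuous fun p : ℝ × ℝ => F p.1 p.2 := by
  rw [continuous_iff_continuousAt]
  intro p
  have hb : Tendsto (fun q : ℝ × ℝ => |q.1 - p.1| + |q.2 - p.2| * F 0 1) (𝓝 p) (𝓝 0) := by
    have : Continuous fun q : ℝ × ℝ => |q.1 - p.1| + |q.2 - p.2| * F 0 1 := by fun_prop
    simpa using this.tendsto p
  refine tendsto_iff_dist_tendsto_zero.2 (squeeze_zero (fun _ => dist_nonneg) (fun q => ?_) hb)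
  have h1 := hF.le_add q.1 q.2 p.1 p.2
  have h2 := hF.le_add p.1 p.2 q.1 q.2
  rw [abs_sub_comm p.1, abs_sub_comm p.2] at h2
  rw [Real.dist_eq, abs_le]
  constructor <;> linarith

lemma continuous_comp (hF : IsNormalizedPlaneNorm F) {X : Type*} [TopologicalSpace X]
    {u v : X → ℝ} (hu : Continuous u) (hv : Continuous v) : Continuous fun s => F (u s) (v s) :=
  hF.continuous.comp (hu.prodMk hv)

lemma convex_comb (hF : IsNormalizedPlaneNorm F) {a b : ℝ} (ha : 0 ≤ a) (hb : 0 ≤ b)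
    (x y x' y' : ℝ) : F (a * x + b * x') (a * y + b * y') ≤ a * F x y + b * F x' y' := by
  have := hF.add (a * x) (a * y) (b * x') (b * y')
  rwa [hF.smul, hF.smul, abs_of_nonneg ha, abs_of_nonneg hb] at this

lemma threePointConvex (hF : IsNormalizedPlaneNorm F) (y : ℝ) :
    ThreePointConvex fun x => F x y := by
  intro a b c hab hbc
  have h1 := hF.convex_comb (sub_nonneg.2 hbc) (sub_nonneg.2 hab) a y c y
  have h2 := hF.smul (c - a) b y
  rw [abs_of_nonneg (by linarith)] at h2
  rw [show (c - b) * a + (b - a) * c = (c - a) * b by ring,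
    show (c - b) * y + (b - a) * y = (c - a) * y by ring, h2] at h1
  exact h1

lemma exists_vertical_bound (hF : IsNormalizedPlaneNorm F) :
    ∃ m, 0 < m ∧ ∀ x y, m * |y| ≤ F x y := by
  set w := F 0 1 with hw
  have hwpos : 0 < w := hF.vertical_pos
  obtain ⟨x₀, -, hx₀⟩ := (isCompact_Icc (a := -(2 * w)) (b := 2 * w)).exists_isMinOn
    ⟨0, by constructor <;> linarith⟩
    (hF.continuous_comp continuous_id continuous_const : Continuous fun x => F x 1).continuousOn
  have hmin : ∀ x, F x₀ 1 ≤ F x 1 := by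
    intro x
    by_cases hx : x ∈ Set.Icc (-(2 * w)) (2 * w)
    · exact hx₀ hx
    · have h0 : F x₀ 1 ≤ w := hx₀ (show (0 : ℝ) ∈ Set.Icc (-(2 * w)) (2 * w) by
        constructor <;> linarith)
      have h1 : 2 * w < |x| := by
        by_contra! h
        exact hx (abs_le.1 h)
      have h2 := hF.le_add x 0 x 1
      rw [hF.horizontal] at h2
      norm_num at h2
      linarith
  refine ⟨F x₀ 1, (hF.nonneg x₀ 1).lt_of_ne fun h => one_ne_zero (hF.eq_zero x₀ 1 h.symm).2, ?_⟩
  intro x y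
  rcases eq_or_ne y 0 with rfl | hy
  · simpa using hF.nonneg x 0
  · have h := hF.smul y (x / y) 1
    rw [mul_div_cancel₀ x hy, mul_one] at h
    rw [h, mul_comm]
    exact mul_le_mul_of_nonneg_left (hmin _) (abs_nonneg y)

/-- A translate of the unit segment of maximal height with both endpoints in the ball of radius
`4 / 3`. -/
lemma exists_highest_segment (hF : IsNormalizedPlaneNorm F) :
    ∃ t Y, 0 < Y ∧ F t Y ≤ 4 / 3 ∧ F (t + 1) Y ≤ 4 / 3 ∧
      ∀ x y, F x y ≤ 4 / 3 → F (x + 1) y ≤ 4 / 3 → y ≤ Y := by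
  obtain ⟨m, hm, hbound⟩ := hF.exists_vertical_bound
  set w := F 0 1 with hw
  have hwpos : 0 < w := hF.vertical_pos
  set K : Set (ℝ × ℝ) := {p | F p.1 p.2 ≤ 4 / 3 ∧ F (p.1 + 1) p.2 ≤ 4 / 3}
  have hclosed : IsClosed K :=
    (isClosed_le hF.continuous continuous_const).inter
      (isClosed_le (hF.continuous_comp (by fun_prop) continuous_snd) continuous_const)
  set B := 4 / 3 / m
  set R := 4 / 3 + B * w
  have hsub : K ⊆ Set.Icc (-R) R ×ˢ Set.Icc (-B) B := by
    rintro ⟨x, y⟩ ⟨h, -⟩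
    have hy : |y| ≤ B := by
      rw [le_div_iff₀ hm]
      have := hbound x y
      simp only at h
      linarith
    have hx : |x| ≤ R := by
      have h1 := hF.le_add x 0 x y
      rw [hF.horizontal, sub_self, abs_zero, zero_sub, abs_neg, zero_add] at h1
      have h2 := mul_le_mul_of_nonneg_right hy hwpos.le
      simp only at h
      simp only [R]
      linarith
    exact ⟨abs_le.1 hx, abs_le.1 hy⟩
  have hcompact : IsCompact K := (isCompact_Icc.prod isCompact_Icc).of_isClosed_subset hclosed hsub
  have hmem : ((-1 / 2, 1 / (2 * w)) : ℝ × ℝ) ∈ K := by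
    have hpos : 0 < 1 / (2 * w) := by positivity
    have h0 : |1 / (2 * w) - 0| * w = 1 / 2 := by
      rw [sub_zero, abs_of_pos hpos]
      field_simp
    have h1 := hF.le_add (-1 / 2) (1 / (2 * w)) 0 0
    have h2 := hF.le_add (-1 / 2 + 1) (1 / (2 * w)) 0 0
    rw [← hw, h0, hF.horizontal] at h1 h2
    norm_num [abs_of_pos] at h1 h2
    constructor <;> norm_num <;> linarith
  obtain ⟨⟨t, Y⟩, ⟨h0, h1⟩, hmax⟩ := hcompact.exists_isMaxOn ⟨_, hmem⟩ continuous_snd.continuousOn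
  exact ⟨t, Y, (by positivity : 0 < 1 / (2 * w)).trans_le (hmax hmem), h0, h1,
    fun x y hx hy => hmax (show (x, y) ∈ K from ⟨hx, hy⟩)⟩

lemma exists_highest_segment_eq (hF : IsNormalizedPlaneNorm F) :
    ∃ t Y, 0 < Y ∧ F t Y = 4 / 3 ∧ F (t + 1) Y = 4 / 3 := by
  obtain ⟨t, Y, hY, h0, h1, hmax⟩ := hF.exists_highest_segment
  have hstrict : ∀ x, F x Y < 4 / 3 → F (x + 1) Y < 4 / 3 → False := by
    intro x hx hx'
    have e0 : ∀ᶠ y in 𝓝[>] Y, F x y < 4 / 3 :=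
      ((hF.continuous_comp continuous_const continuous_id).tendsto Y).eventually_lt_const hx
        |>.filter_mono nhdsWithin_le_nhds
    have e1 : ∀ᶠ y in 𝓝[>] Y, F (x + 1) y < 4 / 3 :=
      ((hF.continuous_comp continuous_const continuous_id).tendsto Y).eventually_lt_const hx'
        |>.filter_mono nhdsWithin_le_nhds
    obtain ⟨y, ⟨hy0, hy1⟩, hy⟩ := ((e0.and e1).and self_mem_nhdsWithin).exists
    exact absurd (hmax x y hy0.le hy1.le) (not_le.2 hy)
  refine ⟨t, Y, hY, h0.antisymm (le_of_not_gt fun h => ?_), h1.antisymm (le_of_not_gt fun h => ?_)⟩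
  · obtain ⟨ε, hε, hε'⟩ := exists_between (lt_min one_pos (sub_pos.2 h))
    rw [lt_min_iff] at hε'
    have hc := hF.threePointConvex Y t (t + 1 - ε) (t + 1) (by linarith) (by linarith)
    have hl := hF.le_add (t - ε) Y t Y
    simp only [sub_self, abs_zero, zero_mul, sub_sub_cancel_left, abs_neg, abs_of_pos hε] at hl
    refine hstrict (t - ε) (by linarith) ?_
    rw [show t - ε + 1 = t + 1 - ε by ring]
    simp only at hc
    nlinarith
  · obtain ⟨ε, hε, hε'⟩ := exists_between (lt_min one_pos (sub_pos.2 h))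
    rw [lt_min_iff] at hε'
    have hc := hF.threePointConvex Y t (t + ε) (t + 1) (by linarith) (by linarith)
    have hl := hF.le_add (t + ε + 1) Y (t + 1) Y
    rw [show t + ε + 1 - (t + 1) = ε by ring] at hl
    simp only [sub_self, abs_zero, zero_mul, abs_of_pos hε] at hl
    refine hstrict (t + ε) ?_ (by linarith)
    simp only at hc
    nlinarith

lemma exists_real_point (hF : IsNormalizedPlaneNorm F) :
    ∃ z Y, 0 < Y ∧ (1 < F z Y ∧ F z Y ≤ 4 / 3) ∧ (1 < F (z + 1) Y ∧ F (z + 1) Y ≤ 4 / 3) ∧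
      4 / 3 < F (z - 1) Y ∧ 4 / 3 < F (z + 2) Y := by
  obtain ⟨t, Y, hY, h0, h1⟩ := hF.exists_highest_segment_eq
  obtain ⟨z, hz⟩ := (hF.threePointConvex Y).exists_unit_interval
    (hF.continuous_comp continuous_id continuous_const)
    (fun x => by
      have := hF.add (x + 3) Y (-x) (-Y)
      rw [hF.neg, add_neg_cancel, hF.horizontal] at this
      norm_num at this
      linarith) h0 h1
  exact ⟨z, Y, hY, hz⟩

/-- Moving slightly towards `(-1 / 2, 0)` makes all inequalities strict, after which the point can
be taken rational. -/
lemma exists_rat_point (hF : IsNormalizedPlaneNorm F) :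
    ∃ q r : ℚ, (0 : ℝ) < r ∧ (1 < F q r ∧ F q r < 4 / 3) ∧ (1 < F (q + 1) r ∧ F (q + 1) r < 4 / 3) ∧
      4 / 3 < F (q - 1) r ∧ 4 / 3 < F (q + 2) r := by
  obtain ⟨z, Y, hY, ⟨h0, h0'⟩, ⟨h1, h1'⟩, h2, h3⟩ := hF.exists_real_point
  set V : Set (ℝ × ℝ) := {p | 0 < p.2 ∧ 1 < F p.1 p.2 ∧ 1 < F (p.1 + 1) p.2 ∧
    4 / 3 < F (p.1 - 1) p.2 ∧ 4 / 3 < F (p.1 + 2) p.2}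
  set S : Set (ℝ × ℝ) := {p | F p.1 p.2 < 4 / 3 ∧ F (p.1 + 1) p.2 < 4 / 3}
  have hc : ∀ c : ℝ, Continuous fun p : ℝ × ℝ => F (p.1 + c) p.2 :=
    fun c => hF.continuous_comp (by fun_prop) continuous_snd
  have hVo : IsOpen V :=
    (isOpen_lt continuous_const continuous_snd).inter <|
      (isOpen_lt continuous_const hF.continuous).inter <|
      (isOpen_lt continuous_const (hc 1)).inter <|
      (isOpen_lt continuous_const (hc (-1))).inter (isOpen_lt continuous_const (hc 2))
  have hSo : IsOpen S :=
    (isOpen_lt hF.continuous continuous_const).inter (isOpen_lt (hc 1) continuous_const)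
  have hne : (V ∩ S).Nonempty := by
    set γ : ℝ → ℝ × ℝ := fun δ => ((1 - δ) * z + δ * (-1 / 2), (1 - δ) * Y + δ * 0) with hγ
    have hγc : Continuous γ := by fun_prop
    have hγV : ∀ᶠ δ in 𝓝[>] (0 : ℝ), γ δ ∈ V := by
      refine (hγc.tendsto 0).eventually (hVo.mem_nhds ?_) |>.filter_mono nhdsWithin_le_nhds
      have : γ 0 = (z, Y) := by simp [hγ]
      rw [this]
      exact ⟨hY, h0, h1, h2, h3⟩
    obtain ⟨δ, hδV, hδ0, hδ1⟩ := (hγV.and (Ioo_mem_nhdsGT one_pos)).exists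
    refine ⟨γ δ, hδV, ?_, ?_⟩
    · have h := hF.convex_comb (sub_nonneg.2 hδ1.le) hδ0.le z Y (-1 / 2) 0
      rw [hF.horizontal (-1 / 2)] at h
      norm_num [abs_of_pos] at h
      simp only [hγ]
      norm_num
      nlinarith
    · have h := hF.convex_comb (sub_nonneg.2 hδ1.le) hδ0.le (z + 1) Y (1 / 2) 0
      rw [hF.horizontal (1 / 2), show (1 - δ) * (z + 1) + δ * (1 / 2) =
        (1 - δ) * z + δ * (-1 / 2) + 1 by ring] at h
      norm_num [abs_of_pos] at h
      simp only [hγ]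
      norm_num
      nlinarith
  obtain ⟨⟨q, r⟩, ⟨hr, a0, a1, a2, a3⟩, b0, b1⟩ :=
    ((Rat.denseRange_cast (𝕜 := ℝ)).prodMap (Rat.denseRange_cast (𝕜 := ℝ))).exists_mem_open
      (hVo.inter hSo) hne
  exact ⟨q, r, hr, ⟨a0, b0⟩, ⟨a1, b1⟩, a2, a3⟩

end IsNormalizedPlaneNorm


/-- For a norm `N` on `ℝ²` with `N((1,0)) = 1` and a positive integer `α`, there exists a
point `p₄` with rational coordinates and positive second coordinate satisfying
`α < N(p₄ - p₁), N(p₄ - p₂) ≤ 4α/3 < N(p₄ - p₀), N(p₄ - p₃)` where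
`p₀ = (0,0), p₁ = (α,0), p₂ = (2α,0), p₃ = (3α,0)`. -/
theorem stmt_1 (N : (Fin 2 → ℝ) → ℝ)
    (hN0 : ∀ x, N x = 0 ↔ x = 0)
    (hNsmul : ∀ (c : ℝ) (x : Fin 2 → ℝ), N (c • x) = |c| * N x)
    (hNadd : ∀ x y : Fin 2 → ℝ, N (x + y) ≤ N x + N y)
    (hN1 : N ![1, 0] = 1)
    (α : ℕ) (hα : 0 < α) :
    ∃ p₄ : Fin 2 → ℝ,
      (∀ i, ∃ r : ℚ, p₄ i = (r : ℝ)) ∧ 0 < p₄ 1 ∧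
      (α : ℝ) < N (p₄ - ![(α : ℝ), 0]) ∧ N (p₄ - ![(α : ℝ), 0]) ≤ 4 * α / 3 ∧
      (α : ℝ) < N (p₄ - ![2 * (α : ℝ), 0]) ∧ N (p₄ - ![2 * (α : ℝ), 0]) ≤ 4 * α / 3 ∧
      4 * (α : ℝ) / 3 < N (p₄ - ![(0 : ℝ), 0]) ∧
      4 * (α : ℝ) / 3 < N (p₄ - ![3 * (α : ℝ), 0]) := by
  have hF : IsNormalizedPlaneNorm fun x y => N ![x, y] :=
    { eq_zero := fun x y h => by
        have h' := (hN0 _).1 h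
        exact ⟨congrFun h' 0, congrFun h' 1⟩
      smul := fun c x y => by simpa using hNsmul c ![x, y]
      add := fun x y x' y' => by simpa using hNadd ![x, y] ![x', y']
      one := hN1 }
  obtain ⟨q, r, hr, ⟨h0, h0'⟩, ⟨h1, h1'⟩, h2, h3⟩ := hF.exists_rat_point
  have hα' : (0 : ℝ) < α := by exact_mod_cast hα
  have key : ∀ c d : ℝ, d = (2 - c) * α →
      N (![(α : ℝ) * (q + 2), (α : ℝ) * r] - ![d, 0]) = α * N ![(q : ℝ) + c, r] := by
    rintro c d rfl
    rw [← abs_of_pos hα', ← hNsmul, abs_of_pos hα']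
    congr 1
    ext i
    fin_cases i
    · simp
      ring
    · simp
  refine ⟨![(α : ℝ) * (q + 2), (α : ℝ) * r], ?_, by simpa using mul_pos hα' hr, ?_⟩
  · intro i
    fin_cases i
    · exact ⟨α * (q + 2), by simp⟩
    · exact ⟨α * r, by simp⟩
  rw [key 1 α (by ring), key 0 (2 * α) (by ring), key 2 0 (by ring), key (-1) (3 * α) (by ring),
    add_zero, ← sub_eq_add_neg]
  refine ⟨?_, ?_, ?_, ?_, ?_, ?_⟩ <;> nlinarith
end

section
/- Let N be a norm on ℝ² with N((1,0)) = 1, let α be a positive real number, and set p₀ = (0,0), p₁ = (α,0), p₂ = (2α,0), p₃ = (3α,0). Then there exists a point s ∈ ℝ² with strictly positive second coordinate such that N(s − p₁) = N(s − p₂) = 4α/3, N(s − p₀) > 4α/3, and N(s − p₃) > 4α/3. -/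
section NormOnPlane

variable {N : (Fin 2 → ℝ) → ℝ}

theorem continuous_of_homogeneous_subadditive
    (hNsmul : ∀ (c : ℝ) (x : Fin 2 → ℝ), N (c • x) = |c| * N x)
    (hNadd : ∀ x y : Fin 2 → ℝ, N (x + y) ≤ N x + N y) : Continuous N := by
  have hconv : ConvexOn ℝ Set.univ N := by
    refine ⟨convex_univ, fun x _ y _ a b ha hb _ => ?_⟩
    have h := hNadd (a • x) (b • y)
    rwa [hNsmul, hNsmul, abs_of_nonneg ha, abs_of_nonneg hb] at h
  exact continuousOn_univ.1 (hconv.continuousOn isOpen_univ)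

theorem nonneg_of_homogeneous_subadditive
    (hNsmul : ∀ (c : ℝ) (x : Fin 2 → ℝ), N (c • x) = |c| * N x)
    (hNadd : ∀ x y : Fin 2 → ℝ, N (x + y) ≤ N x + N y) (x : Fin 2 → ℝ) : 0 ≤ N x := by
  have h0 := hNsmul 0 0
  have h1 := hNsmul (-1) x
  have h2 := hNadd x ((-1 : ℝ) • x)
  have h3 : x + (-1 : ℝ) • x = 0 := by simp
  simp at h0
  rw [h3, h0, h1] at h2
  norm_num at h2
  linarith

theorem isCompact_setOf_norm_le
    (hN0 : ∀ x, N x = 0 ↔ x = 0)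
    (hNsmul : ∀ (c : ℝ) (x : Fin 2 → ℝ), N (c • x) = |c| * N x)
    (hNadd : ∀ x y : Fin 2 → ℝ, N (x + y) ≤ N x + N y) (r : ℝ) :
    IsCompact {x | N x ≤ r} := by
  have hcont := continuous_of_homogeneous_subadditive hNsmul hNadd
  obtain ⟨z, hz, hmin⟩ := (isCompact_sphere (0 : Fin 2 → ℝ) 1).exists_isMinOn
    (NormedSpace.sphere_nonempty.2 zero_le_one) hcont.continuousOn
  have hzpos : 0 < N z := by
    refine lt_of_le_of_ne (nonneg_of_homogeneous_subadditive hNsmul hNadd z) fun h => ?_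
    rw [(hN0 z).1 h.symm] at hz
    simp at hz
  refine Metric.isCompact_of_isClosed_isBounded (isClosed_le hcont continuous_const)
    ((Metric.isBounded_closedBall (x := (0 : Fin 2 → ℝ)) (r := r / N z)).subset fun x hx => ?_)
  rw [mem_closedBall_zero_iff, le_div_iff₀ hzpos]
  refine le_trans ?_ hx
  rcases eq_or_ne x 0 with rfl | hx0
  · simp [(hN0 0).2 rfl]
  have hxpos : 0 < ‖x‖ := norm_pos_iff.2 hx0
  have h : N z ≤ N (‖x‖⁻¹ • x) := hmin (by simp [norm_smul, hxpos.ne'])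
  rw [hNsmul, abs_of_pos (inv_pos.2 hxpos), ← div_eq_inv_mul, le_div_iff₀ hxpos] at h
  linarith

/-- The circles of radius `r` around two points of the `x`-axis at distance `α` meet above the axis
in a point further than `r` from the next two points, when `α < 2 * r < 3 * α`. -/
theorem exists_equidistant_point
    (hN0 : ∀ x, N x = 0 ↔ x = 0)
    (hNsmul : ∀ (c : ℝ) (x : Fin 2 → ℝ), N (c • x) = |c| * N x)
    (hNadd : ∀ x y : Fin 2 → ℝ, N (x + y) ≤ N x + N y)
    (hN1 : N ![1, 0] = 1) {α r : ℝ} (hα : 0 < α) (hr : α < 2 * r) (hr' : 2 * r < 3 * α) :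
    ∃ t y : ℝ, 0 < y ∧ N ![t, y] = r ∧ N ![t - α, y] = r ∧
      r < N ![t + α, y] ∧ r < N ![t - 2 * α, y] := by
  have hcont := continuous_of_homogeneous_subadditive hNsmul hNadd
  have hcompact := isCompact_setOf_norm_le hN0 hNsmul hNadd r
  have hcomb (a b x y x' y' : ℝ) (ha : 0 ≤ a) (hb : 0 ≤ b) :
      N ![a * x + b * x', a * y + b * y'] ≤ a * N ![x, y] + b * N ![x', y'] := by
    have h := hNadd (a • ![x, y]) (b • ![x', y'])
    rw [hNsmul, hNsmul, abs_of_nonneg ha, abs_of_nonneg hb] at h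
    simpa using h
  have hline (x : ℝ) : N ![x, 0] = |x| := by
    have h := hNsmul x ![1, 0]
    simpa [hN1] using h
  have hshift (x y d : ℝ) : N ![x + d, y] ≤ N ![x, y] + |d| := by
    have h := hNadd ![x, y] ![d, 0]
    rw [hline] at h
    simpa using h
  have hdist (x x' y : ℝ) : |x - x'| ≤ N ![x, y] + N ![x', y] := by
    have h := hNadd ![x, y] ((-1 : ℝ) • ![x', y])
    rw [hNsmul] at h
    rw [← hline]
    simpa [← sub_eq_add_neg] using h
  -- The highest point which, together with its left translate by `α`, lies in the ball.
  obtain ⟨t, y, hy, ht, ht', hmax⟩ : ∃ t y : ℝ, 0 < y ∧ N ![t, y] ≤ r ∧ N ![t - α, y] ≤ r ∧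
      ∀ t' y' : ℝ, N ![t', y'] ≤ r → N ![t' - α, y'] ≤ r → y' ≤ y := by
    have hC : 0 < N ![0, 1] := by
      refine lt_of_le_of_ne (nonneg_of_homogeneous_subadditive hNsmul hNadd _) fun h => ?_
      have := congrFun ((hN0 _).1 h.symm) 1
      simp at this
    have hy₀ : 0 < (r - α / 2) / N ![0, 1] := div_pos (by linarith) hC
    have hmem (x : ℝ) (hx : |x| = α / 2) : N ![x, (r - α / 2) / N ![0, 1]] ≤ r := by
      have h := hNadd ![x, 0] (((r - α / 2) / N ![0, 1]) • ![0, 1])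
      rw [hNsmul, hline, hx, abs_of_pos hy₀, div_mul_cancel₀ _ hC.ne'] at h
      simp at h
      linarith
    have hclosed : IsClosed {u : Fin 2 → ℝ | N ![u 0 - α, u 1] ≤ r} :=
      isClosed_le (hcont.comp (by fun_prop)) continuous_const
    obtain ⟨u, hu, humax⟩ := (hcompact.inter_right hclosed).exists_isMaxOn
      (f := fun u : Fin 2 → ℝ => u 1)
      ⟨![α / 2, (r - α / 2) / N ![0, 1]], hmem _ (abs_of_pos (by linarith)), by
        refine hmem _ ?_
        simp only [Matrix.cons_val_zero]
        rw [abs_of_neg (by linarith)]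
        ring⟩ (by fun_prop)
    have hle (t' y' : ℝ) (h : N ![t', y'] ≤ r) (h' : N ![t' - α, y'] ≤ r) : y' ≤ u 1 :=
      humax (show ![t', y'] ∈ _ from ⟨h, by simpa using h'⟩)
    have hu_eq : ![u 0, u 1] = u := by
      ext i; fin_cases i <;> rfl
    refine ⟨u 0, u 1, hy₀.trans_le (hle (α / 2) _ (hmem _ (abs_of_pos (by linarith))) ?_), ?_,
      hu.2, hle⟩
    · refine hmem _ ?_
      rw [abs_of_neg (by linarith)]
      ring
    · rw [hu_eq]
      exact hu.1
  have hI : IsCompact {x : ℝ | N ![x, y] ≤ r} := by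
    refine Metric.isCompact_of_isClosed_isBounded
      (isClosed_le (hcont.comp (by fun_prop)) continuous_const)
      ((Metric.isBounded_closedBall (x := t) (r := r + r)).subset fun x hx => ?_)
    rw [Metric.mem_closedBall, Real.dist_eq]
    exact (hdist x t y).trans (add_le_add hx ht)
  obtain ⟨a, ha, hamin⟩ := hI.exists_isLeast ⟨t, ht⟩
  obtain ⟨b, hb, hbmax⟩ := hI.exists_isGreatest ⟨t, ht⟩
  have hat := hamin ht'
  have htb := hbmax ht
  have hleft (x : ℝ) (hx : x < a) : r < N ![x, y] :=
    lt_of_not_ge fun h => (hamin h).not_gt hx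
  have hright (x : ℝ) (hx : b < x) : r < N ![x, y] :=
    lt_of_not_ge fun h => (hbmax h).not_gt hx
  simp only [Set.mem_ofPred_eq] at ha hb
  have hab := (le_abs_self _).trans ((hdist b a y).trans (add_le_add hb ha))
  rcases (show α ≤ b - a by linarith).eq_or_lt with heq | hlt
  · refine ⟨b, y, hy, ?_, ?_, hright _ (by linarith), hleft _ (by linarith)⟩
    · refine hb.antisymm (le_of_not_gt fun h => ?_)
      have h1 := hshift b y (r - N ![b, y])
      rw [abs_of_pos (by linarith)] at h1
      linarith [hright (b + (r - N ![b, y])) (by linarith)]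
    · rw [show b - α = a by linarith]
      refine ha.antisymm (le_of_not_gt fun h => ?_)
      have h1 := hshift a y (-(r - N ![a, y]))
      rw [abs_neg, abs_of_pos (by linarith)] at h1
      linarith [hleft (a + -(r - N ![a, y])) (by linarith)]
  · have hba : 0 < b - a := hα.trans hlt
    -- A chord longer than `α` could be shortened and raised unless it lies at the top of the ball.
    have htop (x y' : ℝ) (h : N ![x, y'] ≤ r) : y' ≤ y := by
      by_contra! hyy
      set c := α / (b - a) with hc
      have hc0 : 0 ≤ c := by positivity
      have hc1 : c < 1 := (div_lt_one hba).2 hlt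
      have hcα : c * (b - a) = α := div_mul_cancel₀ _ hba.ne'
      have h1 := hcomb c (1 - c) b y x y' hc0 (by linarith)
      have h2 := hcomb c (1 - c) a y x y' hc0 (by linarith)
      have h3 := hmax (c * b + (1 - c) * x) (c * y + (1 - c) * y') (by nlinarith) (by
        rw [show c * b + (1 - c) * x - α = c * a + (1 - c) * x by linarith]
        nlinarith)
      nlinarith
    have hge (x : ℝ) : r ≤ N ![x, y] := by
      by_contra! h
      have hpos : 0 < N ![x, y] := by
        refine lt_of_le_of_ne (nonneg_of_homogeneous_subadditive hNsmul hNadd _) fun h => ?_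
        have := congrFun ((hN0 _).1 h.symm) 1
        simp at this
        exact hy.ne' this
      have h1 : N ![r / N ![x, y] * x, r / N ![x, y] * y] = r := by
        have h2 := hNsmul (r / N ![x, y]) ![x, y]
        rw [abs_of_pos (div_pos (by linarith) hpos), div_mul_cancel₀ _ hpos.ne'] at h2
        simpa using h2
      have h2 := htop _ _ h1.le
      have h3 : 1 < r / N ![x, y] := (one_lt_div hpos).2 h
      nlinarith
    have hmid (x : ℝ) (hax : a ≤ x) (hxb : x ≤ b) : N ![x, y] ≤ r := by
      have h := hcomb ((b - x) / (b - a)) ((x - a) / (b - a)) a y b y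
        (div_nonneg (by linarith) hba.le) (div_nonneg (by linarith) hba.le)
      have hs : (b - x) / (b - a) + (x - a) / (b - a) = 1 := by field_simp; ring
      rw [← add_mul, hs, one_mul,
        show (b - x) / (b - a) * a + (x - a) / (b - a) * b = x by field_simp; ring] at h
      have h1 := mul_le_mul_of_nonneg_left ha (div_nonneg (sub_nonneg.2 hxb) hba.le)
      have h2 := mul_le_mul_of_nonneg_left hb (div_nonneg (sub_nonneg.2 hax) hba.le)
      calc N ![x, y] ≤ _ := h
        _ ≤ _ := add_le_add h1 h2
        _ = r := by rw [← add_mul, hs, one_mul]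
    refine ⟨(a + b + α) / 2, y, hy, ?_, ?_, hright _ (by linarith), hleft _ (by linarith)⟩
    · exact (hmid _ (by linarith) (by linarith)).antisymm (hge _)
    · exact (hmid _ (by linarith) (by linarith)).antisymm (hge _)

end NormOnPlane

/-- For a norm `N` on `ℝ²` with `N((1,0)) = 1` and a positive real `α`, there exists a point
`s` with positive second coordinate such that `N(s - p₁) = N(s - p₂) = 4α/3`,
`N(s - p₀) > 4α/3` and `N(s - p₃) > 4α/3`, where `p₀ = (0,0)`, `p₁ = (α,0)`, `p₂ = (2α,0)`,
`p₃ = (3α,0)`. -/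
theorem stmt_2 (N : (Fin 2 → ℝ) → ℝ)
    (hN0 : ∀ x, N x = 0 ↔ x = 0)
    (hNsmul : ∀ (c : ℝ) (x : Fin 2 → ℝ), N (c • x) = |c| * N x)
    (hNadd : ∀ x y : Fin 2 → ℝ, N (x + y) ≤ N x + N y)
    (hN1 : N ![1, 0] = 1)
    (α : ℝ) (hα : 0 < α) :
    ∃ s : Fin 2 → ℝ, 0 < s 1 ∧
      N (s - ![α, 0]) = 4 * α / 3 ∧
      N (s - ![2 * α, 0]) = 4 * α / 3 ∧
      4 * α / 3 < N (s - ![(0 : ℝ), 0]) ∧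
      4 * α / 3 < N (s - ![3 * α, 0]) := by
  obtain ⟨t, y, hy, h1, h2, h0, h3⟩ := exists_equidistant_point hN0 hNsmul hNadd hN1
    (α := α) (r := 4 * α / 3) hα (by linarith) (by linarith)
  have hsub (c : ℝ) : ![t + α, y] - ![c, 0] = ![t + α - c, y] := by simp
  refine ⟨![t + α, y], hy, ?_⟩
  simp only [hsub]
  refine ⟨?_, ?_, ?_, ?_⟩
  · rwa [add_sub_cancel_right]
  · rwa [show t + α - 2 * α = t - α by ring]
  · rwa [sub_zero]
  · rwa [show t + α - 3 * α = t - 2 * α by ring]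
end

section
/- Let N be a norm on ℝ² with N((1,0)) = 1, let α be a positive integer, set p₀ = (0,0), p₁ = (α,0), p₂ = (2α,0), p₃ = (3α,0), and let p₄ ∈ ℝ² have strictly positive second coordinate. Assume: (a) α < N(p₄ − p₁) ≤ N(p₄ − p₂); (b) N(p₄ − p₂) + 1 ≤ min{N(p₄ − p₀), N(p₄ − p₃), 2α}; (c) α + 1 ≤ N(p₄ − p₂). Put v₁ = p₂ − p₁, v₂ = p₄ − p₁, and let L = {p₁ + a·v₁ + b·v₂ : a, b ∈ ℤ}. If p, q ∈ L are such that q − p does not belong to the set {0, v₁, −v₁, v₂, −v₂, v₁ − v₂, v₂ − v₁}, then N(p − q) ≥ N(p₄ − p₂) + 1. -/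
namespace Seminorm

variable {E : Type*} [AddCommGroup E] [Module ℝ E] (p : Seminorm ℝ E)

theorem mul_map_add_smul_le (x y : E) {b : ℝ} (hb : 0 ≤ b) (a k : ℝ) :
    b * p (y + k • x) ≤ p (a • x + b • y) + |a - b * k| * p x := by
  have h : b • (y + k • x) = (a • x + b • y) - (a - b * k) • x := by module
  calc b * p (y + k • x) = p (b • (y + k • x)) := by
        rw [map_smul_eq_mul, Real.norm_of_nonneg hb]
    _ ≤ p (a • x + b • y) + p ((a - b * k) • x) := h ▸ map_sub_le_add p _ _
    _ = _ := by rw [map_smul_eq_mul, Real.norm_eq_abs]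

/-- Along the ray from `u` through `u + x`, a convex function that increases on the first unit
step keeps growing. -/
theorem mul_map_add_le_of_le (u x : E) (hle : p u ≤ p (u + x)) {a b : ℝ}
    (hb : 0 ≤ b) (hab : b ≤ a) : b * p (u + x) ≤ p (a • x + b • u) := by
  have h : a • (u + x) = (a • x + b • u) + (a - b) • u := by module
  have h1 : a * p (u + x) ≤ p (a • x + b • u) + (a - b) * p u := by
    calc a * p (u + x) = p (a • (u + x)) := by
          rw [map_smul_eq_mul, Real.norm_of_nonneg (hb.trans hab)]
      _ ≤ p (a • x + b • u) + p ((a - b) • u) := h ▸ map_add_le_add p _ _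
      _ = _ := by rw [map_smul_eq_mul, Real.norm_of_nonneg (sub_nonneg.2 hab)]
  nlinarith [mul_le_mul_of_nonneg_left hle (sub_nonneg.2 hab)]

/-- A lattice vector `a • x + b • y` with `b > 0` that is not a side of a fundamental triangle is
longer than `y - x` by at least one. -/
theorem map_sub_add_one_le_of_pos {x y : E} (hx : 1 ≤ p x) (hxy : p x < p y)
    (hy : p y ≤ p (y - x)) (h_right : p (y - x) + 1 ≤ p (y + x))
    (h_left : p (y - x) + 1 ≤ p (y - (2 : ℝ) • x)) (h_two : p (y - x) + 1 ≤ 2 * p x)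
    (h_ge : p x + 1 ≤ p (y - x)) {a b : ℤ} (hb : 0 < b)
    (h_zero : ¬(a = 0 ∧ b = 1)) (h_neg : ¬(a = -1 ∧ b = 1)) :
    p (y - x) + 1 ≤ p ((a : ℝ) • x + (b : ℝ) • y) := by
  have hbR : (1 : ℝ) ≤ b := by exact_mod_cast hb
  have hb0 : (0 : ℝ) ≤ b := by linarith
  rcases le_or_gt b a with hab | hab
  · have h := p.mul_map_add_le_of_le y x (by linarith) hb0 (Int.cast_le.2 hab)
    nlinarith
  rcases le_or_gt a (-2 * b) with hab' | hab'
  · have hR : (a : ℝ) ≤ -2 * b := by exact_mod_cast hab'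
    have e : y - x + -x = y - (2 : ℝ) • x := by module
    have h := p.mul_map_add_le_of_le (y - x) (-x) (by rw [e]; linarith) hb0
      (show (b : ℝ) ≤ -a - b by linarith)
    rw [e, show (-(a : ℝ) - b) • (-x) + (b : ℝ) • (y - x) = (a : ℝ) • x + (b : ℝ) • y by
      module] at h
    nlinarith
  have hb2 : 2 ≤ b := by omega
  have hm2 := p.mul_map_add_smul_le x y hb0 a (-2)
  have hm1 := p.mul_map_add_smul_le x y hb0 a (-1)
  have h0 := p.mul_map_add_smul_le x y hb0 a 0
  have h1 := p.mul_map_add_smul_le x y hb0 a 1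
  rw [show y + (-2 : ℝ) • x = y - (2 : ℝ) • x by module] at hm2
  rw [show y + (-1 : ℝ) • x = y - x by module] at hm1
  rw [show y + (0 : ℝ) • x = y by module] at h0
  rw [show y + (1 : ℝ) • x = y + x by module] at h1
  rcases hb2.eq_or_lt with rfl | hb3
  · have ha : a = -3 ∨ a = -2 ∨ a = -1 ∨ a = 0 ∨ a = 1 := by omega
    rcases ha with rfl | rfl | rfl | rfl | rfl <;> norm_num at hm2 hm1 h0 h1 ⊢ <;> linarith
  · have hb3R : (3 : ℝ) ≤ b := by exact_mod_cast hb3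
    have hlow : -2 * (b : ℝ) ≤ a := by exact_mod_cast hab'.le
    have hhigh : (a : ℝ) ≤ b := by exact_mod_cast hab.le
    suffices (b : ℝ) * p (y - x) ≤ 2 * p ((a : ℝ) • x + (b : ℝ) • y) by nlinarith
    rcases le_total (a : ℝ) (-b) with hs | hs
    · rw [abs_of_nonneg (by linarith)] at hm2
      rw [abs_of_nonpos (by linarith)] at hm1
      nlinarith
    rcases le_total (a : ℝ) 0 with ht | ht
    · rw [abs_of_nonneg (by linarith)] at hm1
      rw [abs_of_nonpos (by linarith)] at h0
      nlinarith
    · rw [abs_of_nonneg (by linarith)] at h0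
      rw [abs_of_nonpos (by linarith)] at h1
      nlinarith

end Seminorm


/-- Lemma 3 of the paper: in the lattice generated by `v₁ = p₂ - p₁` and `v₂ = p₄ - p₁`
(translated to `p₁`), any two lattice points that do not belong to a common fundamental
triangle are at `N`-distance at least `N(p₄ - p₂) + 1`. -/
theorem stmt_3 (N : (Fin 2 → ℝ) → ℝ)
    (hN0 : ∀ x, N x = 0 ↔ x = 0)
    (hNsmul : ∀ (c : ℝ) (x : Fin 2 → ℝ), N (c • x) = |c| * N x)
    (hNadd : ∀ x y : Fin 2 → ℝ, N (x + y) ≤ N x + N y)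
    (hN1 : N ![1, 0] = 1)
    (α : ℕ) (hα : 0 < α)
    (p₄ : Fin 2 → ℝ) (hp₄ : 0 < p₄ 1)
    (ha1 : (α : ℝ) < N (p₄ - ![(α : ℝ), 0]))
    (ha2 : N (p₄ - ![(α : ℝ), 0]) ≤ N (p₄ - ![2 * (α : ℝ), 0]))
    (hb : N (p₄ - ![2 * (α : ℝ), 0]) + 1 ≤
      min (min (N (p₄ - ![(0 : ℝ), 0])) (N (p₄ - ![3 * (α : ℝ), 0]))) (2 * α))
    (hc : (α : ℝ) + 1 ≤ N (p₄ - ![2 * (α : ℝ), 0])) :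
    let p₁ : Fin 2 → ℝ := ![(α : ℝ), 0]
    let v₁ : Fin 2 → ℝ := ![2 * (α : ℝ), 0] - p₁
    let v₂ : Fin 2 → ℝ := p₄ - p₁
    let L : Set (Fin 2 → ℝ) := {p | ∃ a b : ℤ, p = p₁ + (a : ℝ) • v₁ + (b : ℝ) • v₂}
    ∀ p q : Fin 2 → ℝ, p ∈ L → q ∈ L →
      q - p ∉ ({0, v₁, -v₁, v₂, -v₂, v₁ - v₂, v₂ - v₁} : Set (Fin 2 → ℝ)) →
      N (p₄ - ![2 * (α : ℝ), 0]) + 1 ≤ N (p - q) := by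
  intro p₁ v₁ v₂ L p q hp hq hpq
  obtain ⟨a, b, rfl⟩ := hp
  obtain ⟨c, d, rfl⟩ := hq
  let S : Seminorm ℝ (Fin 2 → ℝ) := Seminorm.of N hNadd hNsmul
  have hv₁ : v₁ = (α : ℝ) • ![1, 0] := by
    ext i; fin_cases i <;> simp [v₁, p₁]; ring
  have hα1 : (1 : ℝ) ≤ α := by exact_mod_cast hα
  have hSv₁ : S v₁ = α := by
    change N v₁ = α
    rw [hv₁, hNsmul, hN1, abs_of_nonneg (by linarith), mul_one]
  have e₀ : p₄ - ![(0 : ℝ), 0] = v₂ + v₁ := by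
    ext i; fin_cases i <;> simp [v₁, v₂, p₁, Matrix.vecHead, Matrix.vecTail]; ring
  have e₂ : p₄ - ![2 * (α : ℝ), 0] = v₂ - v₁ := by
    ext i; fin_cases i <;> simp [v₁, v₂, p₁, Matrix.vecHead, Matrix.vecTail]
  have e₃ : p₄ - ![3 * (α : ℝ), 0] = v₂ - (2 : ℝ) • v₁ := by
    ext i; fin_cases i <;> simp [v₁, v₂, p₁, Matrix.vecHead, Matrix.vecTail]; ring
  rw [e₂] at ha2 hb hc ⊢
  rw [e₀, e₃, le_min_iff, le_min_iff] at hb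
  obtain ⟨⟨h_right, h_left⟩, h_two⟩ := hb
  have key {m n : ℤ} (hn : 0 < n) (h_zero : ¬(m = 0 ∧ n = 1)) (h_neg : ¬(m = -1 ∧ n = 1)) :
      S (v₂ - v₁) + 1 ≤ S ((m : ℝ) • v₁ + (n : ℝ) • v₂) :=
    S.map_sub_add_one_le_of_pos (by rwa [hSv₁]) (by rw [hSv₁]; exact ha1) ha2 h_right h_left
      (by rw [hSv₁]; exact h_two) (by rw [hSv₁]; exact hc) hn h_zero h_neg
  change S (v₂ - v₁) + 1 ≤ S _
  have hdiff : p₁ + (a : ℝ) • v₁ + (b : ℝ) • v₂ - (p₁ + (c : ℝ) • v₁ + (d : ℝ) • v₂)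
      = ((a - c : ℤ) : ℝ) • v₁ + ((b - d : ℤ) : ℝ) • v₂ := by
    push_cast; module
  have hdiff' : p₁ + (c : ℝ) • v₁ + (d : ℝ) • v₂ - (p₁ + (a : ℝ) • v₁ + (b : ℝ) • v₂)
      = -(((a - c : ℤ) : ℝ) • v₁ + ((b - d : ℤ) : ℝ) • v₂) := by
    push_cast; module
  rw [hdiff'] at hpq
  rw [hdiff]
  generalize a - c = m at *
  generalize b - d = n at *
  simp only [Set.mem_insert_iff, Set.mem_singleton_iff, not_or] at hpq
  obtain ⟨g₀, g₁, g₂, g₃, g₄, g₅, g₆⟩ := hpq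
  rcases lt_trichotomy n 0 with hn | rfl | hn
  · rw [← map_neg_eq_map S ((m : ℝ) • v₁ + _), show -((m : ℝ) • v₁ + (n : ℝ) • v₂)
      = ((-m : ℤ) : ℝ) • v₁ + ((-n : ℤ) : ℝ) • v₂ by push_cast; module]
    refine key (by omega) ?_ ?_
    · rintro ⟨hm, hn'⟩
      obtain rfl : m = 0 := by omega
      obtain rfl : n = -1 := by omega
      exact g₃ (by push_cast; module)
    · rintro ⟨hm, hn'⟩
      obtain rfl : m = 1 := by omega
      obtain rfl : n = -1 := by omega
      exact g₆ (by push_cast; module)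
  · have hm : 2 ≤ |m| := by
      by_contra! hlt
      obtain ⟨hl, hr⟩ := abs_lt.1 hlt
      obtain rfl | rfl | rfl : m = -1 ∨ m = 0 ∨ m = 1 := by omega
      · exact g₁ (by push_cast; module)
      · exact g₀ (by push_cast; module)
      · exact g₂ (by push_cast; module)
    have hmR : (2 : ℝ) ≤ |(m : ℝ)| := by exact_mod_cast hm
    rw [Int.cast_zero, zero_smul, add_zero, map_smul_eq_mul, Real.norm_eq_abs, hSv₁]
    refine h_two.trans ?_
    gcongr
  · refine key hn ?_ ?_
    · rintro ⟨rfl, rfl⟩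
      exact g₄ (by push_cast; module)
    · rintro ⟨rfl, rfl⟩
      exact g₅ (by push_cast; module)
end

section
/- Let N be a norm on ℝ² with N((1,0)) = 1, let α be an integer with α ≥ 3, set p₀ = (0,0), p₁ = (α,0), p₂ = (2α,0), p₃ = (3α,0), and let p₄ ∈ ℝ² have strictly positive second coordinate. Assume: (a) α < N(p₄ − p₁) ≤ N(p₄ − p₂) ≤ 4α/3; (b) N(p₄ − p₂) + 1 ≤ min{N(p₄ − p₀), N(p₄ − p₃), 2α}; (c) α + 1 ≤ N(p₄ − p₂). Put v₁ = p₂ − p₁, v₂ = p₄ − p₁, Δ = N(v₁) + N(v₂) + N(v₁ − v₂), and let L = {p₁ + a·v₁ + b·v₂ : a, b ∈ ℤ}. Then any three pairwise distinct points q₁, q₂, q₃ ∈ L either form a fundamental triangle, i.e. all three pairwise differences q₁ − q₂, q₂ − q₃, q₃ − q₁ belong to {v₁, −v₁, v₂, −v₂, v₁ − v₂, v₂ − v₁}, or satisfy N(q₁ − q₂) + N(q₂ − q₃) + N(q₃ − q₁) ≥ Δ + 1. -/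
/-- The coordinate vectors `(x, y)` of the edges of a fundamental triangle. -/
def IsFundamentalEdge (x y : ℤ) : Prop :=
  (x = 1 ∧ y = 0) ∨ (x = -1 ∧ y = 0) ∨ (x = 0 ∧ y = 1) ∨ (x = 0 ∧ y = -1) ∨
    (x = 1 ∧ y = -1) ∨ (x = -1 ∧ y = 1)

lemma IsFundamentalEdge.neg {x y : ℤ} (h : IsFundamentalEdge x y) :
    IsFundamentalEdge (-x) (-y) := by
  unfold IsFundamentalEdge at *
  omega

/-- A seminorm on `ℤ²` whose values near the origin satisfy the inequalities required of the
lattice generated by `v₁` and `v₂`. -/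
structure IsAdmissible (g : ℤ → ℤ → ℝ) : Prop where
  smul : ∀ n x y : ℤ, g (n * x) (n * y) = |(n : ℝ)| * g x y
  add_le : ∀ x y x' y' : ℤ, g (x + x') (y + y') ≤ g x y + g x' y'
  three_le : 3 ≤ g 1 0
  lt_b : g 1 0 < g 0 1
  b_le_c : g 0 1 ≤ g (-1) 1
  c_le : g (-1) 1 ≤ 4 * g 1 0 / 3
  c_le_right : g (-1) 1 + 1 ≤ g 1 1
  c_le_left : g (-1) 1 + 1 ≤ g (-2) 1
  c_le_two : g (-1) 1 + 1 ≤ 2 * g 1 0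
  le_c : g 1 0 + 1 ≤ g (-1) 1

namespace IsAdmissible

variable {g : ℤ → ℤ → ℝ}

lemma neg (hg : IsAdmissible g) (x y : ℤ) : g (-x) (-y) = g x y := by
  simpa using hg.smul (-1) x y

lemma horizontal (hg : IsAdmissible g) (x : ℤ) : g x 0 = |(x : ℝ)| * g 1 0 := by
  simpa using hg.smul x 1 0

/-- Outside the two shortest points, the first row has values at least `c + 1`. -/
lemma first_row (hg : IsAdmissible g) {k : ℤ} (h0 : k ≠ 0) (h1 : k ≠ -1) :
    g (-1) 1 + 1 ≤ g k 1 := by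
  have hbc := hg.b_le_c
  have hr := hg.c_le_right
  have hl := hg.c_le_left
  rcases lt_or_ge k 0 with hk | hk
  · have h := hg.add_le k 1 ((-k - 2) * (-1)) ((-k - 2) * 1)
    rw [hg.smul, show k + (-k - 2) * (-1) = (-k - 1) * (-2) by ring,
      show 1 + (-k - 2) * 1 = (-k - 1) * 1 by ring, hg.smul] at h
    have hk2 : (k : ℝ) ≤ -2 := by exact_mod_cast (by omega : k ≤ -2)
    push_cast at h
    rw [abs_of_nonneg (by linarith), abs_of_nonneg (by linarith)] at h
    nlinarith
  · have h := hg.add_le k 1 ((k - 1) * 0) ((k - 1) * 1)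
    rw [hg.smul, show k + (k - 1) * 0 = k * 1 by ring,
      show 1 + (k - 1) * 1 = k * 1 by ring, hg.smul] at h
    have hk1 : (1 : ℝ) ≤ k := by exact_mod_cast (by omega : 1 ≤ k)
    push_cast at h
    rw [abs_of_nonneg (by linarith), abs_of_nonneg (by linarith)] at h
    nlinarith

lemma b_le_first_row (hg : IsAdmissible g) (k : ℤ) : g 0 1 ≤ g k 1 := by
  have hbc := hg.b_le_c
  by_cases h0 : k = 0
  · rw [h0]
  by_cases h1 : k = -1
  · rwa [h1]
  linarith [hg.first_row h0 h1]

lemma c_le_first_row (hg : IsAdmissible g) {k : ℤ} (h0 : k ≠ 0) : g (-1) 1 ≤ g k 1 := by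
  by_cases h1 : k = -1
  · rw [h1]
  linarith [hg.first_row h0 h1]

lemma first_row_add (hg : IsAdmissible g) {k l : ℤ} (h : k ≠ l) :
    g 0 1 + g (-1) 1 ≤ g k 1 + g l 1 := by
  by_cases h0 : k = 0
  · linarith [hg.b_le_first_row k, hg.c_le_first_row (k := l) (by omega)]
  · linarith [hg.b_le_first_row l, hg.c_le_first_row h0]

/-- The seminorm grows at least linearly with the height. -/
lemma height_le (hg : IsAdmissible g) (x : ℤ) {y : ℤ} (hy : 0 ≤ y) :
    y * (g 0 1 + g (-1) 1 - g 1 0) ≤ 2 * g x y := by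
  rcases hy.eq_or_lt with rfl | hy
  · have := hg.horizontal x
    have := hg.three_le
    have : 0 ≤ |(x : ℝ)| * g 1 0 := by positivity
    simp only [Int.cast_zero, zero_mul]
    linarith
  set q := x / y with hq
  set r := x % y with hr
  have hx : y * q + r = x := Int.mul_ediv_add_emod x y
  have hr0 : 0 ≤ r := Int.emod_nonneg _ hy.ne'
  have hry : r < y := Int.emod_lt_of_pos _ hy
  have h1 := hg.add_le x y (-r) 0
  have h2 := hg.add_le x y (y - r) 0
  rw [show x + -r = y * q by linarith, show y + 0 = y * 1 by ring, hg.smul,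
    hg.horizontal] at h1
  rw [show x + (y - r) = y * (q + 1) by linarith, show y + 0 = y * 1 by ring, hg.smul,
    hg.horizontal] at h2
  have hyR : (0 : ℝ) < y := by exact_mod_cast hy
  have hrR : (0 : ℝ) ≤ r := by exact_mod_cast hr0
  have hryR : (r : ℝ) ≤ y := by exact_mod_cast hry.le
  push_cast at h1 h2
  rw [abs_of_pos hyR, abs_neg, abs_of_nonneg hrR] at h1
  rw [abs_of_pos hyR, abs_of_nonneg (by linarith)] at h2
  have h3 := hg.first_row_add (k := q) (l := q + 1) (by omega)
  nlinarith

/-- The perimeter gap for triangles two of whose edge vectors point upwards. -/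
lemma perimeter_of_nonneg (hg : IsAdmissible g) {x y x' y' : ℤ} (hy : 0 ≤ y) (hy' : 0 ≤ y')
    (h : ¬(x = 0 ∧ y = 0)) (h' : ¬(x' = 0 ∧ y' = 0)) (hs : ¬(x + x' = 0 ∧ y + y' = 0)) :
    (IsFundamentalEdge x y ∧ IsFundamentalEdge x' y' ∧
      IsFundamentalEdge (x + x') (y + y')) ∨
    g 1 0 + g 0 1 + g (-1) 1 + 1 ≤ g x y + g x' y' + g (x + x') (y + y') := by
  have a3 := hg.three_le
  have hab := hg.lt_b
  have hbc := hg.b_le_c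
  have hc := hg.c_le
  have hc2 := hg.c_le_two
  have hac := hg.le_c
  have t1 := hg.height_le x hy
  have t2 := hg.height_le x' hy'
  have t3 := hg.height_le (x + x') (add_nonneg hy hy')
  have horiz : ∀ z n : ℤ, n ≤ |z| → n * g 1 0 ≤ g z 0 := fun z n hn ↦ by
    rw [hg.horizontal z]
    exact mul_le_mul_of_nonneg_right (by exact_mod_cast hn) (by linarith)
  obtain hh | hh : 3 ≤ y + y' ∨ y + y' < 3 := le_or_gt _ _
  · right
    have : (3 : ℝ) ≤ y + y' := by exact_mod_cast hh
    push_cast at t3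
    nlinarith
  obtain ⟨rfl, rfl⟩ | ⟨rfl, rfl⟩ | ⟨rfl, rfl⟩ | ⟨rfl, rfl⟩ | ⟨rfl, rfl⟩ | ⟨rfl, rfl⟩ :
      (y = 0 ∧ y' = 0) ∨ (y = 0 ∧ y' = 1) ∨ (y = 1 ∧ y' = 0) ∨ (y = 0 ∧ y' = 2) ∨
      (y = 2 ∧ y' = 0) ∨ (y = 1 ∧ y' = 1) := by omega
  · right
    have h4 : (4 : ℤ) ≤ |x| + |x'| + |x + x'| := by grind
    have h4R : (4 : ℝ) ≤ |(x : ℝ)| + |(x' : ℝ)| + |(x : ℝ) + x'| := by exact_mod_cast h4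
    rw [zero_add, hg.horizontal x, hg.horizontal x', hg.horizontal (x + x')]
    push_cast
    nlinarith
  · have hx : x ≠ 0 := by simpa using h
    rw [zero_add]
    have e1 := hg.first_row_add (k := x') (l := x + x') (by omega)
    obtain h2 | h2 : 2 ≤ |x| ∨ |x| < 2 := le_or_gt _ _
    · right
      have := horiz x 2 h2
      push_cast at this
      linarith
    · have := horiz x 1 (Int.one_le_abs hx)
      push_cast at this
      by_cases k0 : x' = 0 ∨ x' = -1
      · by_cases l0 : x + x' = 0 ∨ x + x' = -1
        · left
          unfold IsFundamentalEdge
          grind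
        · right
          have := hg.first_row (k := x + x') (by tauto) (by tauto)
          linarith [hg.b_le_first_row x']
      · right
        have := hg.first_row (k := x') (by tauto) (by tauto)
        linarith [hg.b_le_first_row (x + x')]
  · have hx : x' ≠ 0 := by simpa using h'
    rw [add_zero]
    have e1 := hg.first_row_add (k := x) (l := x + x') (by omega)
    obtain h2 | h2 : 2 ≤ |x'| ∨ |x'| < 2 := le_or_gt _ _
    · right
      have := horiz x' 2 h2
      push_cast at this
      linarith
    · have := horiz x' 1 (Int.one_le_abs hx)
      push_cast at this
      by_cases k0 : x = 0 ∨ x = -1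
      · by_cases l0 : x + x' = 0 ∨ x + x' = -1
        · left
          unfold IsFundamentalEdge
          grind
        · right
          have := hg.first_row (k := x + x') (by tauto) (by tauto)
          linarith [hg.b_le_first_row x]
      · right
        have := hg.first_row (k := x) (by tauto) (by tauto)
        linarith [hg.b_le_first_row (x + x')]
  · right
    have := horiz x 1 (Int.one_le_abs (by simpa using h))
    rw [zero_add] at t3 ⊢
    push_cast at this t2 t3
    linarith
  · right
    have := horiz x' 1 (Int.one_le_abs (by simpa using h'))
    rw [add_zero] at t3 ⊢
    push_cast at this t1 t3
    linarith
  · right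
    by_cases hxx : x = x'
    · subst hxx
      have e := hg.smul 2 x 1
      rw [show 2 * x = x + x by ring, show (2 : ℤ) * 1 = 1 + 1 by norm_num] at e
      norm_num at e ⊢
      linarith [hg.b_le_first_row x]
    · rw [show (1 : ℤ) + 1 = 2 by norm_num] at t3 ⊢
      push_cast at t3
      linarith [hg.first_row_add hxx]

lemma perimeter (hg : IsAdmissible g) {x₁ y₁ x₂ y₂ x₃ y₃ : ℤ}
    (hx : x₁ + x₂ + x₃ = 0) (hy : y₁ + y₂ + y₃ = 0)
    (h₁ : ¬(x₁ = 0 ∧ y₁ = 0)) (h₂ : ¬(x₂ = 0 ∧ y₂ = 0)) (h₃ : ¬(x₃ = 0 ∧ y₃ = 0)) :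
    (IsFundamentalEdge x₁ y₁ ∧ IsFundamentalEdge x₂ y₂ ∧ IsFundamentalEdge x₃ y₃) ∨
    g 1 0 + g 0 1 + g (-1) 1 + 1 ≤ g x₁ y₁ + g x₂ y₂ + g x₃ y₃ := by
  have key : ∀ {x₁ y₁ x₂ y₂ x₃ y₃ : ℤ}, x₁ + x₂ + x₃ = 0 → y₁ + y₂ + y₃ = 0 →
      ¬(x₁ = 0 ∧ y₁ = 0) → ¬(x₂ = 0 ∧ y₂ = 0) → ¬(x₃ = 0 ∧ y₃ = 0) →
      (0 ≤ y₁ ∧ 0 ≤ y₂) ∨ (y₁ ≤ 0 ∧ y₂ ≤ 0) →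
      (IsFundamentalEdge x₁ y₁ ∧ IsFundamentalEdge x₂ y₂ ∧ IsFundamentalEdge x₃ y₃) ∨
      g 1 0 + g 0 1 + g (-1) 1 + 1 ≤ g x₁ y₁ + g x₂ y₂ + g x₃ y₃ := by
    intro x₁ y₁ x₂ y₂ x₃ y₃ hx hy h₁ h₂ h₃ hsign
    rcases hsign with ⟨s₁, s₂⟩ | ⟨s₁, s₂⟩
    · have := hg.perimeter_of_nonneg s₁ s₂ h₁ h₂ (by omega)
      rw [show x₁ + x₂ = -x₃ by omega, show y₁ + y₂ = -y₃ by omega, hg.neg] at this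
      refine this.imp_left fun ⟨a, b, c⟩ ↦ ⟨a, b, ?_⟩
      simpa using c.neg
    · have := hg.perimeter_of_nonneg (x := -x₁) (y := -y₁) (x' := -x₂) (y' := -y₂)
        (by omega) (by omega) (by omega) (by omega) (by omega)
      rw [show -x₁ + -x₂ = x₃ by omega, show -y₁ + -y₂ = y₃ by omega, hg.neg, hg.neg] at this
      refine this.imp_left fun ⟨a, b, c⟩ ↦ ⟨?_, ?_, c⟩
      · simpa using a.neg
      · simpa using b.neg
  obtain h | h | h : ((0 ≤ y₁ ∧ 0 ≤ y₂) ∨ (y₁ ≤ 0 ∧ y₂ ≤ 0)) ∨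
      ((0 ≤ y₂ ∧ 0 ≤ y₃) ∨ (y₂ ≤ 0 ∧ y₃ ≤ 0)) ∨
      ((0 ≤ y₃ ∧ 0 ≤ y₁) ∨ (y₃ ≤ 0 ∧ y₁ ≤ 0)) := by omega
  · exact key hx hy h₁ h₂ h₃ h
  · rcases key (by omega) (by omega) h₂ h₃ h₁ h with h | h
    · tauto
    · right; linarith
  · rcases key (by omega) (by omega) h₃ h₁ h₂ h with h | h
    · tauto
    · right; linarith

end IsAdmissible


/-- Wrapping up the lattice construction: with `α ≥ 3` and `p₄` satisfying conditions
(a), (b), (c), any three pairwise distinct points of the lattice generated by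
`v₁ = p₂ - p₁`, `v₂ = p₄ - p₁` (translated to `p₁`) either form a fundamental triangle or
have `N`-perimeter at least `Δ + 1`, where `Δ` is the perimeter of the fundamental
triangle. -/
theorem stmt_4 (N : (Fin 2 → ℝ) → ℝ)
    (hN0 : ∀ x, N x = 0 ↔ x = 0)
    (hNsmul : ∀ (c : ℝ) (x : Fin 2 → ℝ), N (c • x) = |c| * N x)
    (hNadd : ∀ x y : Fin 2 → ℝ, N (x + y) ≤ N x + N y)
    (hN1 : N ![1, 0] = 1)
    (α : ℤ) (hα : 3 ≤ α)
    (p₄ : Fin 2 → ℝ) (hp₄ : 0 < p₄ 1)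
    (ha1 : (α : ℝ) < N (p₄ - ![(α : ℝ), 0]))
    (ha2 : N (p₄ - ![(α : ℝ), 0]) ≤ N (p₄ - ![2 * (α : ℝ), 0]))
    (ha3 : N (p₄ - ![2 * (α : ℝ), 0]) ≤ 4 * α / 3)
    (hb : N (p₄ - ![2 * (α : ℝ), 0]) + 1 ≤
      min (min (N (p₄ - ![(0 : ℝ), 0])) (N (p₄ - ![3 * (α : ℝ), 0]))) (2 * α))
    (hc : (α : ℝ) + 1 ≤ N (p₄ - ![2 * (α : ℝ), 0])) :
    let p₁ : Fin 2 → ℝ := ![(α : ℝ), 0]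
    let v₁ : Fin 2 → ℝ := ![2 * (α : ℝ), 0] - p₁
    let v₂ : Fin 2 → ℝ := p₄ - p₁
    let Δ : ℝ := N v₁ + N v₂ + N (v₁ - v₂)
    let L : Set (Fin 2 → ℝ) := {p | ∃ a b : ℤ, p = p₁ + (a : ℝ) • v₁ + (b : ℝ) • v₂}
    let S : Set (Fin 2 → ℝ) := {v₁, -v₁, v₂, -v₂, v₁ - v₂, v₂ - v₁}
    ∀ q₁ q₂ q₃ : Fin 2 → ℝ, q₁ ∈ L → q₂ ∈ L → q₃ ∈ L →
      q₁ ≠ q₂ → q₂ ≠ q₃ → q₃ ≠ q₁ →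
      (q₁ - q₂ ∈ S ∧ q₂ - q₃ ∈ S ∧ q₃ - q₁ ∈ S) ∨
        Δ + 1 ≤ N (q₁ - q₂) + N (q₂ - q₃) + N (q₃ - q₁) := by
  intro p₁ v₁ v₂ Δ L S
  have haxis : ∀ c : ℝ, ![c, 0] = c • ![(1 : ℝ), 0] := fun c ↦ by simp
  have hv₁ : v₁ = (α : ℝ) • ![1, 0] := by
    simp only [v₁, p₁]
    rw [haxis (2 * α), haxis α]
    module
  have hα3 : (3 : ℝ) ≤ α := by exact_mod_cast hα
  have hNv₁ : N v₁ = α := by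
    rw [hv₁, hNsmul, hN1, abs_of_nonneg (by linarith), mul_one]
  have hNneg : ∀ x, N (-x) = N x := fun x ↦ by simpa using hNsmul (-1) x
  have hc' : N (v₁ - v₂) = N (p₄ - ![2 * (α : ℝ), 0]) := by
    rw [← hNneg]
    congr 1
    simp only [v₁, v₂]
    abel
  simp only [le_min_iff] at hb
  obtain ⟨⟨hb₁, hb₂⟩, hb₃⟩ := hb
  set g : ℤ → ℤ → ℝ := fun x y ↦ N ((x : ℝ) • v₁ + (y : ℝ) • v₂) with hgdef
  have g10 : g 1 0 = α := by simp [hgdef, hNv₁]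
  have row : ∀ (k : ℤ) (c : ℝ), c = (1 - k) * α → g k 1 = N (p₄ - ![c, 0]) := by
    rintro k _ rfl
    simp only [hgdef, hv₁, v₂, p₁]
    rw [haxis α, haxis ((1 - k) * α)]
    congr 1
    push_cast
    module
  have g01 := row 0 α (by push_cast; ring)
  have gc := row (-1) (2 * α) (by push_cast; ring)
  have g11 := row 1 0 (by push_cast; ring)
  have g21 := row (-2) (3 * α) (by push_cast; ring)
  have hg : IsAdmissible g :=
    { smul := fun n x y ↦ by
        simp only [hgdef]
        rw [← hNsmul]
        congr 1
        push_cast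
        module
      add_le := fun x y x' y' ↦ by
        simp only [hgdef]
        refine le_trans (le_of_eq ?_) (hNadd _ _)
        congr 1
        push_cast
        module
      three_le := by rwa [g10]
      lt_b := by rwa [g10, g01]
      b_le_c := by rwa [g01, gc]
      c_le := by rwa [gc, g10]
      c_le_right := by rwa [gc, g11]
      c_le_left := by rwa [gc, g21]
      c_le_two := by rwa [gc, g10]
      le_c := by rwa [gc, g10] }
  have hS : ∀ x y : ℤ, IsFundamentalEdge x y → (x : ℝ) • v₁ + (y : ℝ) • v₂ ∈ S := by
    rintro x y (⟨rfl, rfl⟩ | ⟨rfl, rfl⟩ | ⟨rfl, rfl⟩ | ⟨rfl, rfl⟩ | ⟨rfl, rfl⟩ | ⟨rfl, rfl⟩)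
    · left; simp
    · right; left; simp
    · right; right; left; simp
    · right; right; right; left; simp
    · right; right; right; right; left; simp [sub_eq_add_neg]
    · right; right; right; right; right; simp [sub_eq_add_neg, add_comm]
  rintro q₁ q₂ q₃ ⟨a₁, b₁, rfl⟩ ⟨a₂, b₂, rfl⟩ ⟨a₃, b₃, rfl⟩ h₁₂ h₂₃ h₃₁
  have hdiff : ∀ a b a' b' : ℤ, p₁ + (a : ℝ) • v₁ + (b : ℝ) • v₂ -
      (p₁ + (a' : ℝ) • v₁ + (b' : ℝ) • v₂) =
      ((a - a' : ℤ) : ℝ) • v₁ + ((b - b' : ℤ) : ℝ) • v₂ := by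
    intro a b a' b'
    push_cast
    module
  have hne : ∀ a b a' b' : ℤ, p₁ + (a : ℝ) • v₁ + (b : ℝ) • v₂ ≠
      p₁ + (a' : ℝ) • v₁ + (b' : ℝ) • v₂ → ¬(a - a' = 0 ∧ b - b' = 0) := by
    rintro a b a' b' h ⟨ha, hb⟩
    rw [sub_eq_zero] at ha hb
    exact h (by rw [ha, hb])
  have hΔ : Δ = g 1 0 + g 0 1 + g (-1) 1 := by
    rw [g10, g01, gc]
    simp only [Δ, hNv₁, hc']
    rfl
  rw [hdiff, hdiff, hdiff, hΔ]
  refine (hg.perimeter (by ring) (by ring) (hne _ _ _ _ h₁₂) (hne _ _ _ _ h₂₃)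
    (hne _ _ _ _ h₃₁)).imp_left ?_
  exact fun ⟨a, b, c⟩ ↦ ⟨hS _ _ a, hS _ _ b, hS _ _ c⟩
end

section
/- Let G be a simple graph on a finite vertex set V and let S ⊆ V. Let H be the simple graph on vertex set V × {0,1} in which (u,a) and (v,b) are adjacent iff either (a = b and u is adjacent to v in G) or (u = v, u ∈ S, and a ≠ b). Then H has a partition into triangles if and only if G has a partition into triangles. -/
/-- `G` has a partition of its vertex set into triangles. -/
def HasTrianglePartition {W : Type*} (G : SimpleGraph W) : Prop :=
  ∃ P : Set (Set W),
    (∀ s ∈ P, s.ncard = 3 ∧ ∀ x ∈ s, ∀ y ∈ s, x ≠ y → G.Adj x y) ∧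
    ∀ w : W, ∃! s, s ∈ P ∧ w ∈ s

/-- If `H` consists of layers `V × {a}` joined only along fibres over `V`, then every triangle
of `H` lies in a single layer. -/
theorem snd_eq_of_mem_triangle {V : Type*} {H : SimpleGraph (V × Bool)}
    (hH : ∀ p q, H.Adj p q → p.2 = q.2 ∨ p.1 = q.1) {s : Set (V × Bool)} (hs : s.ncard = 3)
    (hadj : ∀ x ∈ s, ∀ y ∈ s, x ≠ y → H.Adj x y) {x y : V × Bool} (hx : x ∈ s) (hy : y ∈ s) :
    x.2 = y.2 := by
  obtain ⟨a, b, c, hab, hac, hbc, rfl⟩ := Set.ncard_eq_three.mp hs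
  have h₁ := hH _ _ (hadj a (by simp) b (by simp) hab)
  have h₂ := hH _ _ (hadj a (by simp) c (by simp) hac)
  have h₃ := hH _ _ (hadj b (by simp) c (by simp) hbc)
  rw [Ne, Prod.ext_iff] at hab hac hbc
  have pigeonhole : ∀ i j k : Bool, i = j ∨ i = k ∨ j = k := by decide
  have h := pigeonhole a.2 b.2 c.2
  clear hs hadj hH pigeonhole
  rcases hx with rfl | rfl | rfl <;> rcases hy with rfl | rfl | rfl <;> grind

/-- The doubling construction: the graph `H` on `V × {0,1}` (two copies of `G` plus a
perfect matching between the copies of the vertices in `S`) has a partition into triangles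
iff `G` has one. -/
theorem stmt_9 (V : Type*) [Fintype V] (G : SimpleGraph V) (S : Set V)
    (H : SimpleGraph (V × Bool))
    (hH : ∀ p q : V × Bool, H.Adj p q ↔
      (p.2 = q.2 ∧ G.Adj p.1 q.1) ∨ (p.1 = q.1 ∧ p.1 ∈ S ∧ p.2 ≠ q.2)) :
    HasTrianglePartition H ↔ HasTrianglePartition G := by
  have hinj (a : Bool) : Function.Injective fun v : V => (v, a) := Prod.mk_left_injective a
  constructor
  · rintro ⟨P, hP, hcover⟩
    refine ⟨{t | (fun v => (v, false)) '' t ∈ P}, fun t ht => ?_, fun v => ?_⟩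
    · obtain ⟨hcard, hadj⟩ := hP _ ht
      rw [Set.ncard_image_of_injective t (hinj false)] at hcard
      refine ⟨hcard, fun x hx y hy hxy => ?_⟩
      have h := hadj _ (Set.mem_image_of_mem _ hx) _ (Set.mem_image_of_mem _ hy)
        ((hinj false).ne hxy)
      simpa [hH] using h
    · obtain ⟨s, ⟨hsP, hvs⟩, huniq⟩ := hcover (v, false)
      obtain ⟨hcard, hadj⟩ := hP s hsP
      have hs : (fun v => (v, false)) '' ((fun v => (v, false)) ⁻¹' s) = s := by
        refine Set.image_preimage_eq_of_subset fun x hx => ⟨x.1, Prod.ext rfl ?_⟩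
        exact snd_eq_of_mem_triangle (x := (v, false))
          (fun p q h => ((hH p q).mp h).imp And.left And.left) hcard hadj hvs hx
      refine ⟨(fun v => (v, false)) ⁻¹' s, ⟨?_, hvs⟩, ?_⟩
      · rwa [Set.mem_ofPred_eq, hs]
      · rintro t ⟨ht, hvt⟩
        rw [← huniq _ ⟨ht, Set.mem_image_of_mem _ hvt⟩, Set.preimage_image_eq t (hinj false)]
  · rintro ⟨P, hP, hcover⟩
    refine ⟨{s | ∃ t ∈ P, ∃ a : Bool, (fun v => (v, a)) '' t = s}, ?_, ?_⟩
    · rintro _ ⟨t, ht, a, rfl⟩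
      obtain ⟨hcard, hadj⟩ := hP t ht
      refine ⟨by rwa [Set.ncard_image_of_injective t (hinj a)], ?_⟩
      rintro _ ⟨x, hx, rfl⟩ _ ⟨y, hy, rfl⟩ hxy
      exact (hH _ _).mpr (.inl ⟨rfl, hadj x hx y hy (ne_of_apply_ne (·, a) hxy)⟩)
    · rintro ⟨v, a⟩
      obtain ⟨t, ⟨htP, hvt⟩, huniq⟩ := hcover v
      refine ⟨_, ⟨⟨t, htP, a, rfl⟩, Set.mem_image_of_mem _ hvt⟩, ?_⟩
      rintro _ ⟨⟨t', ht', b, rfl⟩, w, hw, hwv⟩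
      obtain ⟨rfl, rfl⟩ := Prod.mk.inj hwv
      rw [huniq t' ⟨ht', hw⟩]
end

section
/- Let 1 ≤ p < ∞, and let G be a 6-regular simple graph on a finite vertex set V with |V| = 3q. Index the coordinates of ℝ^s by the 2-element subsets of V, and for each v ∈ V define the point P(v) whose coordinate indexed by {u,w} equals 1 if v ∈ {u,w} and {u,w} is not an edge of G, and equals 0 otherwise. Then for all distinct u, v ∈ V, the L_p distance between P(u) and P(v) equals (6q − 14)^{1/p} if u and v are adjacent in G, and equals (6q − 16)^{1/p} if u and v are not adjacent. -/
section NonEdgePoint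

variable {V : Type*} [Fintype V] [DecidableEq V] (G : SimpleGraph V) [DecidableRel G.Adj]

/-- The indicator vector of the non-edges of `G` that contain `v`, indexed by the 2-element
subsets of the vertex set. -/
def nonEdgePoint (v : V) (e : {e : Finset V // e.card = 2}) : ℝ :=
  if v ∈ e.1 ∧ ∀ u ∈ e.1, ∀ w ∈ e.1, ¬ G.Adj u w then 1 else 0

theorem nonEdgePoint_eq_zero_or_one (v : V) (e : {e : Finset V // e.card = 2}) :
    nonEdgePoint G v e = 0 ∨ nonEdgePoint G v e = 1 := by
  unfold nonEdgePoint
  split_ifs <;> simp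

theorem sum_nonEdgePoint (v : V) :
    ∑ e, nonEdgePoint G v e = Gᶜ.degree v := by
  simp only [nonEdgePoint, Finset.sum_boole, ← SimpleGraph.card_neighborFinset_eq_degree]
  congr 1
  symm
  refine Finset.card_bij
    (fun w hw => ⟨{v, w}, Finset.card_pair (by simp at hw; exact hw.1)⟩) ?_ ?_ ?_
  · intro w hw
    simp only [SimpleGraph.mem_neighborFinset, SimpleGraph.compl_adj] at hw
    simp [hw.2, G.adj_comm w v]
  · intro a ha b hb hab
    simp only [SimpleGraph.mem_neighborFinset, SimpleGraph.compl_adj] at ha hb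
    have h : a ∈ ({v, b} : Finset V) := by
      rw [← Subtype.mk.inj hab]
      simp
    simp only [Finset.mem_insert, Finset.mem_singleton] at h
    exact h.resolve_left (Ne.symm ha.1)
  · rintro ⟨e, he⟩ h
    obtain ⟨x, y, hxy, rfl⟩ := Finset.card_eq_two.mp he
    simp only [Finset.mem_filter, Finset.mem_univ, true_and] at h
    obtain ⟨hv, hadj⟩ := h
    simp only [Finset.mem_insert, Finset.mem_singleton] at hv
    rcases hv with rfl | rfl
    · exact ⟨y, by simp [hxy, hadj v (by simp) y (by simp)], rfl⟩
    · exact ⟨x, by simp [hxy.symm, hadj v (by simp) x (by simp)],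
        Subtype.ext (Finset.pair_comm v x)⟩

theorem sum_nonEdgePoint_mul {u v : V} (huv : u ≠ v) :
    ∑ e, nonEdgePoint G u e * nonEdgePoint G v e = if G.Adj u v then 0 else 1 := by
  rw [Finset.sum_eq_single ⟨{u, v}, Finset.card_pair huv⟩]
  · by_cases h : G.Adj u v <;> simp [nonEdgePoint, h, G.adj_comm v u]
  · rintro ⟨e, he⟩ - hne
    by_cases hu : u ∈ e
    · have hv : v ∉ e := fun hv => hne <| Subtype.ext <| Eq.symm <|
        Finset.eq_of_subset_of_card_le (by simp [Finset.insert_subset_iff, hu, hv])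
          (by rw [he, Finset.card_pair huv])
      simp [nonEdgePoint, hv]
    · simp [nonEdgePoint, hu]
  · simp

theorem sum_abs_nonEdgePoint_sub_rpow {p : ℝ} (hp : p ≠ 0) {u v : V} (huv : u ≠ v) :
    ∑ e, |nonEdgePoint G u e - nonEdgePoint G v e| ^ p =
      Gᶜ.degree u + Gᶜ.degree v - 2 * if G.Adj u v then 0 else 1 := by
  rw [← sum_nonEdgePoint, ← sum_nonEdgePoint, ← sum_nonEdgePoint_mul G huv, Finset.mul_sum,
    ← Finset.sum_add_distrib, ← Finset.sum_sub_distrib]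
  refine Finset.sum_congr rfl fun e _ => ?_
  rcases nonEdgePoint_eq_zero_or_one G u e with hu | hu <;>
    rcases nonEdgePoint_eq_zero_or_one G v e with hv | hv <;>
    norm_num [hu, hv, Real.zero_rpow hp]

end NonEdgePoint

/-- In the reduction for the `L_p` norm: embedding the vertices of a 6-regular graph on
`3q` vertices into `ℝ^s` with coordinates indexed by 2-element vertex subsets, the `L_p`
distance between distinct points is `(6q - 14)^(1/p)` for adjacent vertices and
`(6q - 16)^(1/p)` for non-adjacent vertices. -/
theorem stmt_12 (p : ℝ) (hp : 1 ≤ p)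
    (V : Type*) [Fintype V] [DecidableEq V] (G : SimpleGraph V) [DecidableRel G.Adj]
    (q : ℕ) (hcard : Fintype.card V = 3 * q)
    (hreg : ∀ v : V, G.degree v = 6) :
    let P : V → {e : Finset V // e.card = 2} → ℝ := fun v e =>
      if v ∈ e.1 ∧ ∀ u ∈ e.1, ∀ w ∈ e.1, ¬ G.Adj u w then 1 else 0
    let d : V → V → ℝ := fun u v =>
      (∑ e : {e : Finset V // e.card = 2}, |P u e - P v e| ^ p) ^ (1 / p)
    ∀ u v : V, u ≠ v →
      (G.Adj u v → d u v = ((6 * q : ℝ) - 14) ^ (1 / p)) ∧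
      (¬ G.Adj u v → d u v = ((6 * q : ℝ) - 16) ^ (1 / p)) := by
  intro P d u v huv
  have hdeg (w : V) : (Gᶜ.degree w : ℝ) = 3 * q - 7 := by
    have h := G.degree_compl w
    have hlt := G.degree_lt_card_verts w
    rw [hreg] at h hlt
    rw [eq_sub_iff_add_eq]
    exact_mod_cast (by omega : Gᶜ.degree w + 7 = 3 * q)
  have hd : d u v = (_ : ℝ) ^ (1 / p) :=
    congrArg (· ^ (1 / p)) (sum_abs_nonEdgePoint_sub_rpow G (by positivity) huv)
  rw [hdeg, hdeg] at hd
  constructor <;> intro h <;> rw [hd] <;> congr 1 <;> simp only [h, if_true, if_false] <;> ring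
end

section
/- Let 1 ≤ p < ∞, and let G be a 6-regular simple graph on vertex set V = V₁ ∪ V₂ ∪ V₃ with V₁, V₂, V₃ pairwise disjoint, |V₁| = |V₂| = |V₃| = q, and every edge of G joining vertices in two different parts. Index the coordinates of ℝ^s by the 2-element subsets of V, and for each v ∈ V define the point P(v) whose coordinate indexed by {u,w} equals 1 if v ∈ {u,w} and {u,w} is not an edge of G, and equals 0 otherwise; set ℓ* = (6q − 14)^{1/p}. Then G has a partition into triangles if and only if there exists a set T of q triples in V₁ × V₂ × V₃ covering every vertex of V exactly once such that Σ_{(x,y,z) ∈ T} [d_p(P(x),P(y)) + d_p(P(y),P(z)) + d_p(P(z),P(x))] ≥ 3q·ℓ*, where d_p denotes the L_p distance. -/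
/-- The point associated with the vertex `v`: its coordinate at a pair `e` is `1` if `e` is a
non-edge containing `v`, and `0` otherwise. -/
noncomputable def nonEdgeIncidence {V : Type*} [Fintype V] [DecidableEq V] (G : SimpleGraph V)
    [DecidableRel G.Adj] (v : V) (e : {e : Finset V // e.card = 2}) : ℝ :=
  if v ∈ e.1 ∧ ∀ u ∈ e.1, ∀ w ∈ e.1, ¬ G.Adj u w then 1 else 0

theorem forall_mem_pair_not_adj_iff {V : Type*} [DecidableEq V] (G : SimpleGraph V) (u w : V) :
    (∀ a ∈ ({u, w} : Finset V), ∀ b ∈ ({u, w} : Finset V), ¬ G.Adj a b) ↔ ¬ G.Adj u w := by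
  simp [G.adj_comm w u]

theorem sum_nonEdgeIncidence {V : Type*} [Fintype V] [DecidableEq V] (G : SimpleGraph V)
    [DecidableRel G.Adj] (v : V) :
    ∑ e, nonEdgeIncidence G v e = (Fintype.card V : ℝ) - 1 - G.degree v := by
  have hcompl : (Finset.univ.filter fun w => v ≠ w ∧ ¬ G.Adj v w).card
      = Gᶜ.degree v := by
    rw [← SimpleGraph.card_neighborFinset_eq_degree]
    congr 1
    ext w
    simp [SimpleGraph.compl_adj]
  have hcard : (Finset.univ.filter fun w => v ≠ w ∧ ¬ G.Adj v w).card
      = (Finset.univ.filter fun e : {e : Finset V // e.card = 2} =>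
          v ∈ e.1 ∧ ∀ u ∈ e.1, ∀ w ∈ e.1, ¬ G.Adj u w).card := by
    refine Finset.card_bij
      (fun w hw => ⟨{v, w}, Finset.card_pair (Finset.mem_filter.1 hw).2.1⟩) ?_ ?_ ?_
    · intro w hw
      simp only [Finset.mem_filter, Finset.mem_univ, true_and] at hw ⊢
      exact ⟨by simp, (forall_mem_pair_not_adj_iff G v w).2 hw.2⟩
    · intro w hw w' hw' h
      simp only [Finset.mem_filter, Finset.mem_univ, true_and] at hw hw'
      have hmem : w ∈ ({v, w'} : Finset V) := by
        have h' : ({v, w} : Finset V) = {v, w'} := congrArg Subtype.val h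
        simp [← h']
      simp only [Finset.mem_insert, Finset.mem_singleton] at hmem
      exact hmem.resolve_left (Ne.symm hw.1)
    · rintro ⟨e, he⟩ hmem
      simp only [Finset.mem_filter, Finset.mem_univ, true_and] at hmem
      obtain ⟨a, b, hab, rfl⟩ := Finset.card_eq_two.1 he
      obtain ⟨hv, hn⟩ := hmem
      rw [forall_mem_pair_not_adj_iff] at hn
      simp only [Finset.mem_insert, Finset.mem_singleton] at hv
      rcases hv with rfl | rfl
      · exact ⟨b, by simp [hab, hn], rfl⟩
      · exact ⟨a, by simp [hab.symm, G.adj_comm v a, hn], Subtype.ext (Finset.pair_comm _ _)⟩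
  have hlt := G.degree_lt_card_verts v
  unfold nonEdgeIncidence
  rw [Finset.sum_boole, ← hcard, hcompl, SimpleGraph.degree_compl,
    Nat.cast_sub (by omega), Nat.cast_sub (by omega)]
  simp

theorem sum_nonEdgeIncidence_mul {V : Type*} [Fintype V] [DecidableEq V] (G : SimpleGraph V)
    [DecidableRel G.Adj] {u v : V} (huv : u ≠ v) :
    ∑ e, nonEdgeIncidence G u e * nonEdgeIncidence G v e = if G.Adj u v then 0 else 1 := by
  have hpair : ∀ e : {e : Finset V // e.card = 2}, u ∈ e.1 → v ∈ e.1 →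
      e = ⟨{u, v}, Finset.card_pair huv⟩ := by
    rintro ⟨e, he⟩ hu hv
    refine Subtype.ext (Finset.eq_of_subset_of_card_le ?_ ?_).symm
    · intro a ha
      simp only [Finset.mem_insert, Finset.mem_singleton] at ha
      rcases ha with rfl | rfl <;> assumption
    · simp [he, Finset.card_pair huv]
  rw [Finset.sum_eq_single (⟨{u, v}, Finset.card_pair huv⟩ : {e : Finset V // e.card = 2})]
  · simp only [nonEdgeIncidence, forall_mem_pair_not_adj_iff]
    by_cases h : G.Adj u v <;> simp [h]
  · intro e _ hne
    by_contra h
    simp only [nonEdgeIncidence, mul_eq_zero, ite_eq_right_iff, not_or, one_ne_zero, imp_false,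
      not_not] at h
    exact hne (hpair e h.1.1 h.2.1)
  · simp

theorem sum_abs_sub_nonEdgeIncidence_rpow {V : Type*} [Fintype V] [DecidableEq V]
    (G : SimpleGraph V) [DecidableRel G.Adj] {p : ℝ} (hp : p ≠ 0) {u v : V} (huv : u ≠ v) :
    ∑ e, |nonEdgeIncidence G u e - nonEdgeIncidence G v e| ^ p =
      2 * (Fintype.card V : ℝ) - 2 - G.degree u - G.degree v - if G.Adj u v then 0 else 2 := by
  have h : ∀ e, |nonEdgeIncidence G u e - nonEdgeIncidence G v e| ^ p =
      nonEdgeIncidence G u e + nonEdgeIncidence G v e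
        - 2 * (nonEdgeIncidence G u e * nonEdgeIncidence G v e) := by
    intro e
    unfold nonEdgeIncidence
    split_ifs <;> norm_num [Real.zero_rpow hp]
  simp only [h, Finset.sum_sub_distrib, Finset.sum_add_distrib, ← Finset.mul_sum,
    sum_nonEdgeIncidence, sum_nonEdgeIncidence_mul G huv]
  split_ifs <;> ring

/-- A three-element set that meets each part of a three-part cover in at most one point is a
transversal of the parts. -/
theorem exists_transversal_of_ncard_eq_three {V : Type*} {A B C s : Set V}
    (hs : s.ncard = 3) (hcover : ∀ v, v ∈ A ∨ v ∈ B ∨ v ∈ C)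
    (hA : (s ∩ A).Subsingleton) (hB : (s ∩ B).Subsingleton) (hC : (s ∩ C).Subsingleton) :
    ∃ a ∈ A, ∃ b ∈ B, ∃ c ∈ C, s = {a, b, c} := by
  have hsplit : s = s ∩ A ∪ s ∩ B ∪ s ∩ C := by
    ext v
    have := hcover v
    simp only [Set.mem_union, Set.mem_inter_iff]
    tauto
  have hle : s.ncard ≤ (s ∩ A).ncard + (s ∩ B).ncard + (s ∩ C).ncard := by
    conv_lhs => rw [hsplit]
    exact (Set.ncard_union_le _ _).trans (Nat.add_le_add_right (Set.ncard_union_le _ _) _)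
  have h1 : (s ∩ A).ncard ≤ 1 := (Set.ncard_le_one hA.finite).2 fun x hx y hy => hA hx hy
  have h2 : (s ∩ B).ncard ≤ 1 := (Set.ncard_le_one hB.finite).2 fun x hx y hy => hB hx hy
  have h3 : (s ∩ C).ncard ≤ 1 := (Set.ncard_le_one hC.finite).2 fun x hx y hy => hC hx hy
  obtain ⟨a, has, ha⟩ := Set.nonempty_of_ncard_ne_zero (s := s ∩ A) (by omega)
  obtain ⟨b, hbs, hb⟩ := Set.nonempty_of_ncard_ne_zero (s := s ∩ B) (by omega)
  obtain ⟨c, hcs, hc⟩ := Set.nonempty_of_ncard_ne_zero (s := s ∩ C) (by omega)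
  refine ⟨a, ha, b, hb, c, hc, Set.Subset.antisymm ?_ ?_⟩
  · intro v hv
    rcases hcover v with h | h | h
    · exact Or.inl (hA ⟨hv, h⟩ ⟨has, ha⟩)
    · exact Or.inr (Or.inl (hB ⟨hv, h⟩ ⟨hbs, hb⟩))
    · exact Or.inr (Or.inr (hC ⟨hv, h⟩ ⟨hcs, hc⟩))
  · rintro v (rfl | rfl | rfl) <;> assumption

/-- In a graph with a tripartition into independent sets `V₁`, `V₂`, `V₃`, the partitions into
triangles are the perfect three-dimensional matchings all of whose triples are triangles. -/
theorem hasTrianglePartition_iff_exists_triples {V : Type*} [Fintype V] [DecidableEq V]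
    (G : SimpleGraph V) (q : ℕ) (V₁ V₂ V₃ : Finset V)
    (h12 : Disjoint V₁ V₂) (h13 : Disjoint V₁ V₃) (h23 : Disjoint V₂ V₃)
    (hunion : V₁ ∪ V₂ ∪ V₃ = Finset.univ) (hc1 : V₁.card = q)
    (htri : ∀ u v : V, G.Adj u v →
      ¬(u ∈ V₁ ∧ v ∈ V₁) ∧ ¬(u ∈ V₂ ∧ v ∈ V₂) ∧ ¬(u ∈ V₃ ∧ v ∈ V₃)) :
    HasTrianglePartition G ↔
      ∃ T : Finset (V × V × V), T.card = q ∧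
        (∀ t ∈ T, t.1 ∈ V₁ ∧ t.2.1 ∈ V₂ ∧ t.2.2 ∈ V₃) ∧
        (∀ v : V, ∃! t, t ∈ T ∧ (v = t.1 ∨ v = t.2.1 ∨ v = t.2.2)) ∧
        ∀ t ∈ T, G.Adj t.1 t.2.1 ∧ G.Adj t.2.1 t.2.2 ∧ G.Adj t.2.2 t.1 := by
  classical
  constructor
  · rintro ⟨S, hS, hSu⟩
    have hcover : ∀ v, v ∈ (V₁ : Set V) ∨ v ∈ (V₂ : Set V) ∨ v ∈ (V₃ : Set V) := by
      intro v
      have := Finset.mem_univ v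
      rw [← hunion] at this
      simpa [or_assoc] using this
    have hsub : ∀ s ∈ S, (s ∩ V₁).Subsingleton ∧ (s ∩ V₂).Subsingleton ∧
        (s ∩ V₃).Subsingleton := by
      intro s hs
      refine ⟨?_, ?_, ?_⟩ <;> intro x hx y hy <;> by_contra hne <;>
        have h := htri x y ((hS s hs).2 x hx.1 y hy.1 hne)
      · exact h.1 ⟨hx.2, hy.2⟩
      · exact h.2.1 ⟨hx.2, hy.2⟩
      · exact h.2.2 ⟨hx.2, hy.2⟩
    have htrans : ∀ s ∈ S, ∃ a ∈ V₁, ∃ b ∈ V₂, ∃ c ∈ V₃, s = {a, b, c} := fun s hs => by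
      obtain ⟨h1, h2, h3⟩ := hsub s hs
      simpa using exists_transversal_of_ncard_eq_three (hS s hs).1 hcover h1 h2 h3
    let T : Finset (V × V × V) := Finset.univ.filter fun t =>
      (t.1 ∈ V₁ ∧ t.2.1 ∈ V₂ ∧ t.2.2 ∈ V₃) ∧ ∃ s ∈ S, t.1 ∈ s ∧ t.2.1 ∈ s ∧ t.2.2 ∈ s
    have hT : ∀ t, t ∈ T ↔ (t.1 ∈ V₁ ∧ t.2.1 ∈ V₂ ∧ t.2.2 ∈ V₃) ∧
        ∃ s ∈ S, t.1 ∈ s ∧ t.2.1 ∈ s ∧ t.2.2 ∈ s := fun t => by simp [T]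
    have hTu : ∀ v : V, ∃! t, t ∈ T ∧ (v = t.1 ∨ v = t.2.1 ∨ v = t.2.2) := by
      intro v
      obtain ⟨s, ⟨hs, hvs⟩, hu⟩ := hSu v
      obtain ⟨a, ha, b, hb, c, hc, rfl⟩ := htrans s hs
      refine ⟨(a, b, c), ⟨(hT _).2 ⟨⟨ha, hb, hc⟩, _, hs, by simp, by simp, by simp⟩,
        by simpa using hvs⟩, ?_⟩
      rintro ⟨x, y, z⟩ ⟨hm, hv⟩
      obtain ⟨⟨hx, hy, hz⟩, s', hs', hxs, hys, hzs⟩ := (hT _).1 hm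
      have hvs' : v ∈ s' := by
        rcases hv with h | h | h <;> rw [h] <;> assumption
      obtain rfl := hu s' ⟨hs', hvs'⟩
      obtain ⟨k1, k2, k3⟩ := hsub _ hs
      exact Prod.ext (k1 ⟨hxs, hx⟩ ⟨by simp, ha⟩)
        (Prod.ext (k2 ⟨hys, hy⟩ ⟨by simp, hb⟩) (k3 ⟨hzs, hz⟩ ⟨by simp, hc⟩))
    refine ⟨T, ?_, fun t ht => ((hT t).1 ht).1, hTu, ?_⟩
    · rw [← hc1]
      refine Finset.card_bij (fun t _ => t.1) (fun t ht => ((hT t).1 ht).1.1) ?_ ?_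
      · intro t ht t' ht' h
        exact (hTu t.1).unique ⟨ht, Or.inl rfl⟩ ⟨ht', Or.inl h⟩
      · intro a ha
        obtain ⟨t, ⟨ht, hat⟩, -⟩ := hTu a
        obtain ⟨-, h2, h3⟩ := ((hT t).1 ht).1
        rcases hat with h | h | h
        · exact ⟨t, ht, h.symm⟩
        · exact (Finset.disjoint_left.1 h12 ha (h ▸ h2)).elim
        · exact (Finset.disjoint_left.1 h13 ha (h ▸ h3)).elim
    · intro t ht
      obtain ⟨⟨h1, h2, h3⟩, s, hs, k1, k2, k3⟩ := (hT t).1 ht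
      have hadj := (hS s hs).2
      exact ⟨hadj _ k1 _ k2 (Finset.disjoint_iff_ne.1 h12 _ h1 _ h2),
        hadj _ k2 _ k3 (Finset.disjoint_iff_ne.1 h23 _ h2 _ h3),
        hadj _ k3 _ k1 (Finset.disjoint_iff_ne.1 h13 _ h1 _ h3).symm⟩
  · rintro ⟨T, -, -, hTu, hadj⟩
    refine ⟨(fun t : V × V × V => ({t.1, t.2.1, t.2.2} : Set V)) '' T, ?_, ?_⟩
    · rintro _ ⟨t, ht, rfl⟩
      obtain ⟨h1, h2, h3⟩ := hadj t ht
      refine ⟨Set.ncard_eq_three.2 ⟨_, _, _, h1.ne, h3.ne.symm, h2.ne, rfl⟩, ?_⟩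
      rintro x (rfl | rfl | rfl) y (rfl | rfl | rfl) hne <;> first
        | exact (hne rfl).elim
        | assumption
        | (apply SimpleGraph.Adj.symm; assumption)
    · intro w
      obtain ⟨t, ⟨ht, hw⟩, hu⟩ := hTu w
      refine ⟨_, ⟨⟨t, ht, rfl⟩, hw⟩, ?_⟩
      rintro _ ⟨⟨t', ht', rfl⟩, hw'⟩
      rw [hu t' ⟨ht', hw'⟩]

/-- Correctness of the reduction for the `L_p` norm: a 6-regular tripartite graph has a
partition into triangles iff the constructed max-3AP instance has a feasible solution of
objective value at least `3q·ℓ*` with `ℓ* = (6q - 14)^(1/p)`. -/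
theorem stmt_13 (p : ℝ) (hp : 1 ≤ p)
    (V : Type*) [Fintype V] [DecidableEq V] (G : SimpleGraph V) [DecidableRel G.Adj]
    (q : ℕ) (V₁ V₂ V₃ : Finset V)
    (h12 : Disjoint V₁ V₂) (h13 : Disjoint V₁ V₃) (h23 : Disjoint V₂ V₃)
    (hunion : V₁ ∪ V₂ ∪ V₃ = Finset.univ)
    (hc1 : V₁.card = q) (hc2 : V₂.card = q) (hc3 : V₃.card = q)
    (hreg : ∀ v : V, G.degree v = 6)
    (htri : ∀ u v : V, G.Adj u v →
      ¬(u ∈ V₁ ∧ v ∈ V₁) ∧ ¬(u ∈ V₂ ∧ v ∈ V₂) ∧ ¬(u ∈ V₃ ∧ v ∈ V₃)) :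
    let P : V → {e : Finset V // e.card = 2} → ℝ := fun v e =>
      if v ∈ e.1 ∧ ∀ u ∈ e.1, ∀ w ∈ e.1, ¬ G.Adj u w then 1 else 0
    let d : V → V → ℝ := fun u v =>
      (∑ e : {e : Finset V // e.card = 2}, |P u e - P v e| ^ p) ^ (1 / p)
    (HasTrianglePartition G ↔
      ∃ T : Finset (V × V × V), T.card = q ∧
        (∀ t ∈ T, t.1 ∈ V₁ ∧ t.2.1 ∈ V₂ ∧ t.2.2 ∈ V₃) ∧
        (∀ v : V, ∃! t, t ∈ T ∧ (v = t.1 ∨ v = t.2.1 ∨ v = t.2.2)) ∧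
        3 * q * ((6 * q : ℝ) - 14) ^ (1 / p) ≤
          ∑ t ∈ T, (d t.1 t.2.1 + d t.2.1 t.2.2 + d t.2.2 t.1)) := by
  intro P d
  rw [hasTrianglePartition_iff_exists_triples G q V₁ V₂ V₃ h12 h13 h23 hunion hc1 htri]
  have hcardV : Fintype.card V = 3 * q := by
    rw [← Finset.card_univ, ← hunion, Finset.card_union_of_disjoint
      (Finset.disjoint_union_left.2 ⟨h13, h23⟩), Finset.card_union_of_disjoint h12, hc1, hc2, hc3]
    ring
  have hd : ∀ u v, u ≠ v →
      d u v = ((6 * q : ℝ) - 14 - if G.Adj u v then 0 else 2) ^ (1 / p) := by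
    intro u v huv
    have h := sum_abs_sub_nonEdgeIncidence_rpow G (p := p) (by linarith) huv
    rw [hreg, hreg, hcardV] at h
    change (∑ e, |nonEdgeIncidence G u e - nonEdgeIncidence G v e| ^ p) ^ (1 / p) = _
    rw [h]
    push_cast
    ring_nf
  have hadj : ∀ u v, G.Adj u v → d u v = ((6 * q : ℝ) - 14) ^ (1 / p) := fun u v h => by
    simp [hd u v h.ne, h]
  have hlt : ∀ u v, u ≠ v → ¬ G.Adj u v → d u v < ((6 * q : ℝ) - 14) ^ (1 / p) := by
    intro u v huv h
    have hq : 3 ≤ q := by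
      have := G.degree_lt_card_verts u
      rw [hreg, hcardV] at this
      omega
    have hq' : (3 : ℝ) ≤ q := by exact_mod_cast hq
    rw [hd u v huv, if_neg h]
    exact Real.rpow_lt_rpow (by linarith) (by linarith) (by positivity)
  have hle : ∀ u v, u ≠ v → d u v ≤ ((6 * q : ℝ) - 14) ^ (1 / p) := fun u v huv => by
    by_cases h : G.Adj u v
    · exact (hadj u v h).le
    · exact (hlt u v huv h).le
  refine exists_congr fun T => and_congr_right fun hTc => and_congr_right fun hTm =>
    and_congr_right fun _ => ?_
  have hconst : ∑ t ∈ T, 3 * ((6 * q : ℝ) - 14) ^ (1 / p)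
      = 3 * q * ((6 * q : ℝ) - 14) ^ (1 / p) := by
    rw [Finset.sum_const, hTc, nsmul_eq_mul]; ring
  have hne : ∀ t ∈ T, t.1 ≠ t.2.1 ∧ t.2.1 ≠ t.2.2 ∧ t.2.2 ≠ t.1 := fun t ht => by
    obtain ⟨h1, h2, h3⟩ := hTm t ht
    exact ⟨Finset.disjoint_iff_ne.1 h12 _ h1 _ h2, Finset.disjoint_iff_ne.1 h23 _ h2 _ h3,
      (Finset.disjoint_iff_ne.1 h13 _ h1 _ h3).symm⟩
  rw [← hconst]
  constructor
  · intro h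
    refine Finset.sum_le_sum fun t ht => ?_
    obtain ⟨k1, k2, k3⟩ := h t ht
    rw [hadj _ _ k1, hadj _ _ k2, hadj _ _ k3]
    linarith
  · intro h
    have hterm : ∀ t ∈ T, d t.1 t.2.1 + d t.2.1 t.2.2 + d t.2.2 t.1
        ≤ 3 * ((6 * q : ℝ) - 14) ^ (1 / p) := fun t ht => by
      obtain ⟨n1, n2, n3⟩ := hne t ht
      linarith [hle _ _ n1, hle _ _ n2, hle _ _ n3]
    have heq := (Finset.sum_eq_sum_iff_of_le hterm).1 (le_antisymm (Finset.sum_le_sum hterm) h)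
    intro t ht
    obtain ⟨n1, n2, n3⟩ := hne t ht
    have he := heq t ht
    have l1 := hle _ _ n1
    have l2 := hle _ _ n2
    have l3 := hle _ _ n3
    refine ⟨?_, ?_, ?_⟩ <;> by_contra hn
    · linarith [hlt _ _ n1 hn]
    · linarith [hlt _ _ n2 hn]
    · linarith [hlt _ _ n3 hn]
end

section
/- Let G be a simple graph on a finite vertex set V in which every vertex has at least one neighbor, and fix for every edge e of G an ordered pair (head(e), tail(e)) of its two endpoints. Index the coordinates of ℝ^s by the edges of G, and for each v ∈ V define the point P(v) whose coordinate indexed by an edge e equals +1 if v = head(e), −1 if v = tail(e), and 0 otherwise. Then for all distinct u, v ∈ V, the L_∞ distance between P(u) and P(v) equals 2 if u and v are adjacent in G, and equals 1 if u and v are not adjacent. -/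
theorem ciSup_eq_of_forall_le_of_eq {ι : Type*} {f : ι → ℝ} {c : ℝ} (hle : ∀ i, f i ≤ c)
    (i : ι) (hi : f i = c) : ⨆ i, f i = c :=
  have : Nonempty ι := ⟨i⟩
  le_antisymm (ciSup_le hle) (hi ▸ le_ciSup ⟨c, Set.forall_mem_range.2 hle⟩ i)

/-- In the reduction for the `L_∞` norm: embedding the vertices of a graph without isolated
vertices into `ℝ^s` with coordinates indexed by the (oriented) edges, the `L_∞` distance
between distinct points is `2` for adjacent vertices and `1` for non-adjacent vertices. -/
theorem stmt_14 (V : Type*) [Fintype V] [DecidableEq V] (G : SimpleGraph V)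
    [DecidableRel G.Adj]
    (hmin : ∀ v : V, ∃ w : V, G.Adj v w)
    (hd tl : {e : Sym2 V // e ∈ G.edgeSet} → V)
    (hor : ∀ e : {e : Sym2 V // e ∈ G.edgeSet}, e.1 = s(hd e, tl e)) :
    let P : V → {e : Sym2 V // e ∈ G.edgeSet} → ℝ := fun v e =>
      if v = hd e then 1 else if v = tl e then -1 else 0
    let d : V → V → ℝ := fun u v => ⨆ e, |P u e - P v e|
    ∀ u v : V, u ≠ v →
      (G.Adj u v → d u v = 2) ∧ (¬ G.Adj u v → d u v = 1) := by
  intro P d u v huv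
  have hadj : ∀ e, G.Adj (hd e) (tl e) := fun e => by
    have h := e.2
    rwa [hor e, SimpleGraph.mem_edgeSet] at h
  refine ⟨fun h => ?_, fun h => ?_⟩
  · refine ciSup_eq_of_forall_le_of_eq (fun e => ?_) ⟨s(u, v), h⟩ ?_
    · simp only [P]
      split_ifs <;> norm_num
    · have he := hor ⟨s(u, v), h⟩
      simp only [P]
      generalize hd ⟨s(u, v), h⟩ = a at *
      generalize tl ⟨s(u, v), h⟩ = b at *
      rcases Sym2.eq_iff.1 he with ⟨rfl, rfl⟩ | ⟨rfl, rfl⟩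
      · simp only [if_true, if_neg huv.symm]
        norm_num
      · simp only [if_true, if_neg huv]
        norm_num
  · obtain ⟨w, hw⟩ := hmin u
    have hvw : v ≠ w := by
      rintro rfl
      exact h hw
    refine ciSup_eq_of_forall_le_of_eq (fun e => ?_) ⟨s(u, w), hw⟩ ?_
    · have ha := hadj e
      simp only [P]
      split_ifs <;> first | (norm_num; done) | grind [G.adj_comm]
    · have he := hor ⟨s(u, w), hw⟩
      simp only [P]
      generalize hd ⟨s(u, w), hw⟩ = a at *
      generalize tl ⟨s(u, w), hw⟩ = b at *
      rcases Sym2.eq_iff.1 he with ⟨rfl, rfl⟩ | ⟨rfl, rfl⟩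
      · simp [huv.symm, hvw]
      · simp [huv.symm, hvw, hw.ne]
end

section
/- Let G be a 6-regular simple graph on vertex set V = V₁ ∪ V₂ ∪ V₃ with V₁, V₂, V₃ pairwise disjoint, |V₁| = |V₂| = |V₃| = q, and every edge of G joining vertices in two different parts. Fix for every edge e of G an ordered pair (head(e), tail(e)) of its two endpoints, index the coordinates of ℝ^s by the edges of G, and for each v ∈ V define the point P(v) whose coordinate indexed by an edge e equals +1 if v = head(e), −1 if v = tail(e), and 0 otherwise. Then G has a partition into triangles if and only if there exists a set T of q triples in V₁ × V₂ × V₃ covering every vertex of V exactly once such that Σ_{(x,y,z) ∈ T} [d_∞(P(x),P(y)) + d_∞(P(y),P(z)) + d_∞(P(z),P(x))] ≥ 6q, where d_∞ denotes the L_∞ distance. -/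
/-- Two signed incidence entries differ by at most `2`. -/
theorem abs_signedIncidence_sub_le_two {W : Type*} [DecidableEq W] (h t u v : W) :
    |(if u = h then (1 : ℝ) else if u = t then -1 else 0) -
      (if v = h then 1 else if v = t then -1 else 0)| ≤ 2 := by
  rw [abs_le]
  split_ifs <;> norm_num

/-- Signed incidence entries of `u` and `v` differ by at most `1` unless `u` and `v` are the
two endpoints. -/
theorem abs_signedIncidence_sub_le_one {W : Type*} [DecidableEq W] {h t u v : W}
    (huv : s(h, t) ≠ s(u, v)) :
    |(if u = h then (1 : ℝ) else if u = t then -1 else 0) -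
      (if v = h then 1 else if v = t then -1 else 0)| ≤ 1 := by
  rw [abs_le]
  split_ifs <;> simp_all

/-- Signed incidence entries of the two endpoints of a non-loop differ by `2`. -/
theorem abs_signedIncidence_sub_eq_two {W : Type*} [DecidableEq W] {h t u v : W}
    (huv : s(h, t) = s(u, v)) (hne : u ≠ v) :
    |(if u = h then (1 : ℝ) else if u = t then -1 else 0) -
      (if v = h then 1 else if v = t then -1 else 0)| = 2 := by
  rcases Sym2.eq_iff.1 huv with ⟨rfl, rfl⟩ | ⟨rfl, rfl⟩
  · rw [if_pos rfl, if_neg hne.symm, if_pos rfl]; norm_num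
  · rw [if_neg hne, if_pos rfl, if_pos rfl]; norm_num

/-- A three-element set with no two elements in a common class of a cover by three classes
consists of one element of each class. -/
theorem exists_transversal_of_ncard_eq_three_s15 {W : Type*} {A B C : Finset W}
    (hcover : ∀ v, v ∈ A ∨ v ∈ B ∨ v ∈ C) {s : Set W} (hs : s.ncard = 3)
    (hsep : ∀ x ∈ s, ∀ y ∈ s, x ≠ y →
      ¬(x ∈ A ∧ y ∈ A) ∧ ¬(x ∈ B ∧ y ∈ B) ∧ ¬(x ∈ C ∧ y ∈ C)) :
    ∃ x y z, x ∈ A ∧ y ∈ B ∧ z ∈ C ∧ s = {x, y, z} := by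
  obtain ⟨a, b, c, hab, hac, hbc, rfl⟩ := Set.ncard_eq_three.1 hs
  have tab := hsep a (by simp) b (by simp) hab
  have tac := hsep a (by simp) c (by simp) hac
  have tbc := hsep b (by simp) c (by simp) hbc
  clear hsep hs
  rcases hcover a with ha | ha | ha <;> rcases hcover b with hb | hb | hb <;>
    simp only [ha, hb, true_and, not_true_eq_false, false_and, and_false] at tab tac tbc <;>
    rcases hcover c with hc | hc | hc <;>
    simp only [hc, not_true_eq_false, false_and, and_false] at tac tbc
  · exact ⟨a, b, c, ha, hb, hc, rfl⟩
  · exact ⟨a, c, b, ha, hc, hb, by rw [Set.pair_comm]⟩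
  · exact ⟨b, a, c, hb, ha, hc, Set.insert_comm a b _⟩
  · exact ⟨c, a, b, hc, ha, hb, by rw [Set.insert_comm c, Set.pair_comm c]⟩
  · exact ⟨b, c, a, hb, hc, ha, by rw [Set.insert_comm a, Set.pair_comm a]⟩
  · exact ⟨c, b, a, hc, hb, ha, by
      rw [Set.insert_comm a, Set.pair_comm a, Set.insert_comm b]⟩

/-- Correctness of the reduction for the `L_∞` norm: a 6-regular tripartite graph has a
partition into triangles iff the constructed max-3AP instance has a feasible solution of
objective value at least `6q`. -/
theorem stmt_15 (V : Type*) [Fintype V] [DecidableEq V] (G : SimpleGraph V)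
    [DecidableRel G.Adj]
    (q : ℕ) (V₁ V₂ V₃ : Finset V)
    (h12 : Disjoint V₁ V₂) (h13 : Disjoint V₁ V₃) (h23 : Disjoint V₂ V₃)
    (hunion : V₁ ∪ V₂ ∪ V₃ = Finset.univ)
    (hc1 : V₁.card = q) (hc2 : V₂.card = q) (hc3 : V₃.card = q)
    (hreg : ∀ v : V, G.degree v = 6)
    (htri : ∀ u v : V, G.Adj u v →
      ¬(u ∈ V₁ ∧ v ∈ V₁) ∧ ¬(u ∈ V₂ ∧ v ∈ V₂) ∧ ¬(u ∈ V₃ ∧ v ∈ V₃))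
    (hd tl : {e : Sym2 V // e ∈ G.edgeSet} → V)
    (hor : ∀ e : {e : Sym2 V // e ∈ G.edgeSet}, e.1 = s(hd e, tl e)) :
    let P : V → {e : Sym2 V // e ∈ G.edgeSet} → ℝ := fun v e =>
      if v = hd e then 1 else if v = tl e then -1 else 0
    let d : V → V → ℝ := fun u v => ⨆ e, |P u e - P v e|
    (HasTrianglePartition G ↔
      ∃ T : Finset (V × V × V), T.card = q ∧
        (∀ t ∈ T, t.1 ∈ V₁ ∧ t.2.1 ∈ V₂ ∧ t.2.2 ∈ V₃) ∧
        (∀ v : V, ∃! t, t ∈ T ∧ (v = t.1 ∨ v = t.2.1 ∨ v = t.2.2)) ∧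
        (6 * q : ℝ) ≤ ∑ t ∈ T, (d t.1 t.2.1 + d t.2.1 t.2.2 + d t.2.2 t.1)) := by
  intro P d
  have d_le (u v : V) : d u v ≤ 2 :=
    Real.iSup_le (fun e => abs_signedIncidence_sub_le_two (hd e) (tl e) u v) (by norm_num)
  have d_adj {u v : V} (h : G.Adj u v) : d u v = 2 := by
    refine le_antisymm (d_le u v) ?_
    let e : {e : Sym2 V // e ∈ G.edgeSet} := ⟨s(u, v), h⟩
    have he : |P u e - P v e| = 2 := abs_signedIncidence_sub_eq_two (hor e).symm h.ne
    rw [← he]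
    exact le_ciSup (f := fun e => |P u e - P v e|) (Set.finite_range _).bddAbove e
  have adj_of_d {u v : V} (h : d u v = 2) : G.Adj u v := by
    by_contra hn
    have : d u v ≤ 1 := by
      refine Real.iSup_le (fun e => abs_signedIncidence_sub_le_one ?_) zero_le_one
      rw [← hor e]
      intro he
      exact hn (by simpa [he] using e.2)
    linarith
  have hmem (v : V) : v ∈ V₁ ∨ v ∈ V₂ ∨ v ∈ V₃ := by
    have := Finset.mem_univ v
    rw [← hunion] at this
    simpa [or_assoc] using this
  have n12 {v : V} (h : v ∈ V₁) : v ∉ V₂ := Finset.disjoint_left.1 h12 h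
  have n13 {v : V} (h : v ∈ V₁) : v ∉ V₃ := Finset.disjoint_left.1 h13 h
  have n23 {v : V} (h : v ∈ V₂) : v ∉ V₃ := Finset.disjoint_left.1 h23 h
  constructor
  · rintro ⟨Q, hQ, hcov⟩
    have hsplit (s : Set V) (hs : s ∈ Q) :
        ∃ x y z, x ∈ V₁ ∧ y ∈ V₂ ∧ z ∈ V₃ ∧ s = {x, y, z} :=
      exists_transversal_of_ncard_eq_three_s15 hmem (hQ s hs).1 fun x hx y hy hne =>
        htri x y ((hQ s hs).2 x hx y hy hne)
    classical
    let T : Finset (V × V × V) := Finset.univ.filter fun t =>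
      (t.1 ∈ V₁ ∧ t.2.1 ∈ V₂ ∧ t.2.2 ∈ V₃) ∧ ({t.1, t.2.1, t.2.2} : Set V) ∈ Q
    have hT (t : V × V × V) : t ∈ T ↔
        (t.1 ∈ V₁ ∧ t.2.1 ∈ V₂ ∧ t.2.2 ∈ V₃) ∧ ({t.1, t.2.1, t.2.2} : Set V) ∈ Q := by
      simp [T]
    have hTcov (v : V) : ∃! t, t ∈ T ∧ (v = t.1 ∨ v = t.2.1 ∨ v = t.2.2) := by
      obtain ⟨s, ⟨hs, hvs⟩, huniq⟩ := hcov v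
      obtain ⟨x, y, z, hx, hy, hz, rfl⟩ := hsplit s hs
      refine ⟨(x, y, z), ⟨(hT _).2 ⟨⟨hx, hy, hz⟩, hs⟩, by simpa using hvs⟩, ?_⟩
      rintro ⟨x', y', z'⟩ ⟨ht, hv⟩
      obtain ⟨⟨hx', hy', hz'⟩, hs'⟩ := (hT _).1 ht
      dsimp only at hx' hy' hz' hs' hv
      have heq := huniq _ ⟨hs', by simpa using hv⟩
      have hxm : x' ∈ ({x, y, z} : Set V) := heq ▸ (by simp)
      have hym : y' ∈ ({x, y, z} : Set V) := heq ▸ (by simp)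
      have hzm : z' ∈ ({x, y, z} : Set V) := heq ▸ (by simp)
      simp only [Set.mem_insert_iff, Set.mem_singleton_iff] at hxm hym hzm
      grind
    have hTcard : T.card = q := by
      rw [← hc1]
      refine Finset.card_nbij Prod.fst (fun t ht => ((hT t).1 ht).1.1) ?_ ?_
      · intro t ht t' ht' h
        exact (hTcov t.1).unique ⟨ht, Or.inl rfl⟩ ⟨ht', Or.inl h⟩
      · intro v hv
        obtain ⟨t, ⟨ht, hvt⟩, -⟩ := hTcov v
        have := ((hT t).1 ht).1
        refine ⟨t, ht, ?_⟩
        rcases hvt with h | h | h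
        · exact h.symm
        · exact absurd (h ▸ this.2.1) (n12 hv)
        · exact absurd (h ▸ this.2.2) (n13 hv)
    refine ⟨T, hTcard, fun t ht => ((hT t).1 ht).1, hTcov, ?_⟩
    have hsum : ∀ t ∈ T, d t.1 t.2.1 + d t.2.1 t.2.2 + d t.2.2 t.1 = 6 := by
      intro t ht
      obtain ⟨⟨hx, hy, hz⟩, hs⟩ := (hT t).1 ht
      have hadj := (hQ _ hs).2
      rw [d_adj (hadj t.1 (by simp) t.2.1 (by simp) fun h => n12 hx (h ▸ hy)),
        d_adj (hadj t.2.1 (by simp) t.2.2 (by simp) fun h => n23 hy (h ▸ hz)),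
        d_adj (hadj t.2.2 (by simp) t.1 (by simp) fun h => n13 hx (h ▸ hz))]
      norm_num
    rw [Finset.sum_congr rfl hsum, Finset.sum_const, hTcard, nsmul_eq_mul, mul_comm]
  · rintro ⟨T, hTcard, -, hTcov, hsum⟩
    have hle : ∀ t ∈ T, d t.1 t.2.1 + d t.2.1 t.2.2 + d t.2.2 t.1 ≤ 6 := fun t _ => by
      linarith [d_le t.1 t.2.1, d_le t.2.1 t.2.2, d_le t.2.2 t.1]
    have htotal : ∑ t ∈ T, (d t.1 t.2.1 + d t.2.1 t.2.2 + d t.2.2 t.1) = ∑ _t ∈ T, (6 : ℝ) := by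
      refine le_antisymm (Finset.sum_le_sum hle) ?_
      rwa [Finset.sum_const, hTcard, nsmul_eq_mul, mul_comm]
    have heq := (Finset.sum_eq_sum_iff_of_le hle).1 htotal
    have hadj (t : V × V × V) (ht : t ∈ T) :
        G.Adj t.1 t.2.1 ∧ G.Adj t.2.1 t.2.2 ∧ G.Adj t.2.2 t.1 := by
      have h := heq t ht
      have h₁ := d_le t.1 t.2.1
      have h₂ := d_le t.2.1 t.2.2
      have h₃ := d_le t.2.2 t.1
      exact ⟨adj_of_d (by linarith), adj_of_d (by linarith), adj_of_d (by linarith)⟩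
    refine ⟨{s | ∃ t ∈ T, s = {t.1, t.2.1, t.2.2}}, ?_, fun v => ?_⟩
    · rintro _ ⟨t, ht, rfl⟩
      obtain ⟨hxy, hyz, hzx⟩ := hadj t ht
      refine ⟨Set.ncard_eq_three.2 ⟨_, _, _, hxy.ne, hzx.ne.symm, hyz.ne, rfl⟩, ?_⟩
      rintro x (rfl | rfl | rfl) y (rfl | rfl | rfl) hne
      all_goals first
        | exact absurd rfl hne
        | assumption
        | exact G.adj_symm (by assumption)
    · obtain ⟨t, ⟨ht, hv⟩, huniq⟩ := hTcov v
      refine ⟨{t.1, t.2.1, t.2.2}, ⟨⟨t, ht, rfl⟩, by simpa using hv⟩, ?_⟩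
      rintro _ ⟨⟨t', ht', rfl⟩, hv'⟩
      rw [huniq t' ⟨ht', by simpa using hv'⟩]
end

section
/- Let N be a norm on ℝ^s and let ε > 0. Then there exist finitely many vectors h₁, …, h_k ∈ ℝ^s such that for every x ∈ ℝ^s: max over 1 ≤ i ≤ k of |⟪hᵢ, x⟫| ≤ N(x) ≤ (1 + ε) · max over 1 ≤ i ≤ k of |⟪hᵢ, x⟫|. In particular, every norm on ℝ^s can be approximated within a factor 1 + ε by a polyhedral norm, i.e. a norm of the form x ↦ maxᵢ |⟪hᵢ, x⟫|. -/
section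

variable {s : ℕ} {N : (Fin s → ℝ) → ℝ}

/-- A seminorm on `ℝ^s` is continuous. -/
theorem continuous_of_abs_smul_of_add_le
    (hNsmul : ∀ (c : ℝ) (x : Fin s → ℝ), N (c • x) = |c| * N x)
    (hNadd : ∀ x y : Fin s → ℝ, N (x + y) ≤ N x + N y) : Continuous N := by
  have hconv : ConvexOn ℝ Set.univ N := by
    refine ⟨convex_univ, fun x _ y _ a b ha hb _ => (hNadd _ _).trans_eq ?_⟩
    rw [hNsmul, hNsmul, abs_of_nonneg ha, abs_of_nonneg hb, smul_eq_mul, smul_eq_mul]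
  exact continuousOn_univ.mp (hconv.continuousOn isOpen_univ)

/-- A seminorm on `ℝ^s` is nonnegative. -/
theorem nonneg_of_abs_smul_of_add_le
    (hNsmul : ∀ (c : ℝ) (x : Fin s → ℝ), N (c • x) = |c| * N x)
    (hNadd : ∀ x y : Fin s → ℝ, N (x + y) ≤ N x + N y) (x : Fin s → ℝ) : 0 ≤ N x := by
  have h0 := hNsmul 0 x
  have h1 := hNsmul (-1) x
  have h2 := hNadd x ((-1 : ℝ) • x)
  simp at h0 h1 h2
  linarith

/-- Every nonzero point has a norming functional, given by the inner product with a vector. -/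
theorem exists_norming_vector
    (hNsmul : ∀ (c : ℝ) (x : Fin s → ℝ), N (c • x) = |c| * N x)
    (hNadd : ∀ x y : Fin s → ℝ, N (x + y) ≤ N x + N y) {x₀ : Fin s → ℝ} (hx₀ : x₀ ≠ 0) :
    ∃ h : Fin s → ℝ, (∀ x, |∑ j, h j * x j| ≤ N x) ∧ ∑ j, h j * x₀ j = N x₀ := by
  have hnonneg := nonneg_of_abs_smul_of_add_le hNsmul hNadd
  obtain ⟨g, hg, hgN⟩ := exists_extension_of_le_sublinear
    (LinearPMap.mkSpanSingleton x₀ (N x₀) hx₀) N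
    (fun c hc x => by rw [hNsmul, abs_of_pos hc]) hNadd (by
      rintro ⟨x, hx⟩
      obtain ⟨c, rfl⟩ := Submodule.mem_span_singleton.mp hx
      refine (LinearPMap.mkSpanSingleton'_apply x₀ (N x₀) _ c hx).trans_le ?_
      rw [hNsmul, smul_eq_mul, RingHom.id_apply]
      exact mul_le_mul_of_nonneg_right (le_abs_self c) (hnonneg x₀))
  have hsum (x : Fin s → ℝ) : ∑ j, g (Pi.single j 1) * x j = g x := by
    rw [LinearMap.pi_apply_eq_sum_univ g x]
    refine Finset.sum_congr rfl fun j _ => ?_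
    rw [smul_eq_mul, mul_comm]
    congr 3
    ext i
    simp [Pi.single_apply, eq_comm]
  refine ⟨fun j => g (Pi.single j 1), fun x => ?_, ?_⟩
  · rw [hsum, abs_le']
    refine ⟨hgN x, ?_⟩
    have h := hgN ((-1 : ℝ) • x)
    rw [hNsmul] at h
    simpa using h
  · rw [hsum]
    exact (hg ⟨x₀, Submodule.mem_span_singleton_self x₀⟩).trans
      (LinearPMap.mkSpanSingleton_apply ℝ ℝ hx₀ (N x₀))

end

/-- Every norm on `ℝ^s` can be approximated within a factor `1 + ε` by a polyhedral norm
`x ↦ maxᵢ |⟪hᵢ, x⟫|` given by finitely many vectors `h₁, …, h_k`. -/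
theorem stmt_16 (s : ℕ) (N : (Fin s → ℝ) → ℝ)
    (hN0 : ∀ x, N x = 0 ↔ x = 0)
    (hNsmul : ∀ (c : ℝ) (x : Fin s → ℝ), N (c • x) = |c| * N x)
    (hNadd : ∀ x y : Fin s → ℝ, N (x + y) ≤ N x + N y)
    (ε : ℝ) (hε : 0 < ε) :
    ∃ (k : ℕ) (hk : 0 < k) (h : Fin k → (Fin s → ℝ)),
      ∀ x : Fin s → ℝ,
        Finset.univ.sup' ⟨⟨0, hk⟩, Finset.mem_univ _⟩ (fun i => |∑ j, h i j * x j|) ≤ N x ∧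
        N x ≤ (1 + ε) *
          Finset.univ.sup' ⟨⟨0, hk⟩, Finset.mem_univ _⟩ (fun i => |∑ j, h i j * x j|) := by
  have hcont := continuous_of_abs_smul_of_add_le hNsmul hNadd
  have hnonneg := nonneg_of_abs_smul_of_add_le hNsmul hNadd
  let H : Type := {h : Fin s → ℝ // ∀ x, |∑ j, h j * x j| ≤ N x}
  obtain ⟨t, ht⟩ := (isCompact_sphere (0 : Fin s → ℝ) 1).elim_finite_subcover
    (fun h : H => {x | N x < (1 + ε) * |∑ j, h.1 j * x j|})
    (fun h => isOpen_lt hcont (by fun_prop)) (by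
      intro x hx
      have hx0 : x ≠ 0 := ne_zero_of_mem_unit_sphere ⟨x, hx⟩
      obtain ⟨h, hle, heq⟩ := exists_norming_vector hNsmul hNadd hx0
      have hpos : 0 < N x := (hnonneg x).lt_of_ne' (mt (hN0 x).mp hx0)
      refine Set.mem_iUnion.mpr ⟨⟨h, hle⟩, ?_⟩
      change N x < (1 + ε) * |∑ j, h j * x j|
      rw [heq, abs_of_pos hpos]
      nlinarith)
  let h0 : H := ⟨0, fun x => by simpa using hnonneg x⟩
  classical
  let F : Finset H := insert h0 t
  refine ⟨F.card, Finset.card_pos.mpr ⟨h0, Finset.mem_insert_self _ _⟩,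
    fun i => (F.equivFin.symm i).1.1, fun x => ⟨?_, ?_⟩⟩
  · exact Finset.sup'_le _ _ fun i _ => (F.equivFin.symm i).1.2 x
  · have hbound (h : H) (hF : h ∈ F) : |∑ j, h.1 j * x j| ≤
        Finset.univ.sup' ⟨⟨0, Finset.card_pos.mpr ⟨h0, Finset.mem_insert_self _ _⟩⟩,
          Finset.mem_univ _⟩ (fun i => |∑ j, (F.equivFin.symm i).1.1 j * x j|) := by
      simpa using Finset.le_sup' (fun i => |∑ j, (F.equivFin.symm i).1.1 j * x j|)
        (Finset.mem_univ (F.equivFin ⟨h, hF⟩))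
    suffices ∃ h ∈ F, N x ≤ (1 + ε) * |∑ j, h.1 j * x j| by
      obtain ⟨h, hF, hle⟩ := this
      exact hle.trans (mul_le_mul_of_nonneg_left (hbound h hF) (by linarith))
    rcases eq_or_ne x 0 with rfl | hx
    · exact ⟨h0, Finset.mem_insert_self _ _, by simp [(hN0 0).mpr rfl]⟩
    have hmem : ‖x‖⁻¹ • x ∈ Metric.sphere (0 : Fin s → ℝ) 1 := by
      simp [norm_smul, hx]
    obtain ⟨h, hht, hlt⟩ := Set.mem_iUnion₂.mp (ht hmem)
    refine ⟨h, Finset.mem_insert_of_mem hht, ?_⟩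
    have hsum : ∑ j, h.1 j * (‖x‖⁻¹ • x) j = ‖x‖⁻¹ * ∑ j, h.1 j * x j := by
      rw [Finset.mul_sum]
      exact Finset.sum_congr rfl fun j _ => mul_left_comm _ _ _
    have hpos : 0 < |‖x‖⁻¹| := abs_pos.mpr (inv_ne_zero (norm_ne_zero_iff.mpr hx))
    rw [Set.mem_ofPred_eq, hNsmul, hsum, abs_mul, mul_left_comm] at hlt
    exact (lt_of_mul_lt_mul_left hlt hpos.le).le
end
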